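/- arXiv:2411.03161 — 5 statements merged into one kernel-verified Lean document; each statement's English description precedes it below -/
import Mathlib

section
/- For all integers n ≥ 1 and s ≥ 1: (1) for every degree d with 0 ≤ d ≤ s, the degree-d graded component of Ann(q_n^s) is zero (equivalently, the d-th catalecticant map of q_n^s is injective); and (2) for every k with 1 ≤ k ≤ s+1, the degree-(s+k) graded component of Ann(q_n^s) equals the direct sum ⊕_{j=0}^{k−1} q_n(Y)^j · H_{n,s+k−2j}, where q_n(Y) = Y_1^2+⋯+Y_n^2. -/
open MvPolynomial

noncomputable def qpoly (n : ℕ) : MvPolynomial (Fin n) ℂ :=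
  ∑ i : Fin n, X i ^ 2

noncomputable def linForm {n : ℕ} (a : Fin n → ℂ) : MvPolynomial (Fin n) ℂ :=
  ∑ i : Fin n, C (a i) * X i

noncomputable def dotC {n : ℕ} (a b : Fin n → ℂ) : ℂ :=
  ∑ i : Fin n, a i * b i

noncomputable def diffOp {n : ℕ} (φ f : MvPolynomial (Fin n) ℂ) : MvPolynomial (Fin n) ℂ :=
  ∑ d ∈ φ.support, φ.coeff d •
    ((List.ofFn fun i : Fin n =>
        ((pderiv i).toLinearMap : MvPolynomial (Fin n) ℂ →ₗ[ℂ] MvPolynomial (Fin n) ℂ) ^ d i).prod f)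

noncomputable def lap {n : ℕ} (f : MvPolynomial (Fin n) ℂ) : MvPolynomial (Fin n) ℂ :=
  ∑ i : Fin n, pderiv i (pderiv i f)

lemma pderiv_commute {n : ℕ} (i j : Fin n) :
    Commute ((pderiv i).toLinearMap : Module.End ℂ (MvPolynomial (Fin n) ℂ))
      (pderiv j).toLinearMap := by
  have h : ⁅pderiv (R := ℂ) i, pderiv (R := ℂ) j⁆ = 0 := by
    ext k : 1
    simp [Derivation.commutator_apply, pderiv_X, Pi.single_apply, apply_ite]
  refine LinearMap.ext fun f => ?_
  have := DFunLike.congr_fun h f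
  simpa [Derivation.commutator_apply, sub_eq_zero] using this

lemma prod_ofFn_pow_add {M : Type*} [Monoid M] {n : ℕ} (a : Fin n → M)
    (ha : ∀ i j, Commute (a i) (a j)) (d e : Fin n → ℕ) :
    (List.ofFn fun i => a i ^ (d i + e i)).prod =
      (List.ofFn fun i => a i ^ d i).prod * (List.ofFn fun i => a i ^ e i).prod := by
  induction n with
  | zero => simp
  | succ n ih =>
    simp only [List.ofFn_succ, List.prod_cons]
    rw [ih (fun i => a i.succ) (fun i j => ha _ _) (fun i => d i.succ) (fun i => e i.succ), pow_add]
    have hc : Commute (a 0 ^ e 0) (List.ofFn fun i : Fin n => a i.succ ^ d i.succ).prod := by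
      refine Commute.list_prod_right _ _ fun x hx => ?_
      obtain ⟨i, rfl⟩ := (List.mem_ofFn' _ _).1 hx
      exact (ha _ _).pow_pow _ _
    simp only [mul_assoc]
    rw [← mul_assoc (a 0 ^ e 0), hc.eq]
    simp only [mul_assoc]

/-- The action of constant-coefficient differential operators, as an algebra homomorphism. -/
noncomputable def diffHom (n : ℕ) :
    MvPolynomial (Fin n) ℂ →ₐ[ℂ] Module.End ℂ (MvPolynomial (Fin n) ℂ) :=
  AddMonoidAlgebra.lift ℂ _ (Fin n →₀ ℕ)
    { toFun := fun d => (List.ofFn fun i : Fin n =>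
        ((pderiv i).toLinearMap : Module.End ℂ (MvPolynomial (Fin n) ℂ)) ^ d.toAdd i).prod
      map_one' := by simp
      map_mul' := fun d e => prod_ofFn_pow_add _ pderiv_commute d.toAdd e.toAdd }

lemma diffOp_eq {n : ℕ} (φ f : MvPolynomial (Fin n) ℂ) : diffOp φ f = diffHom n φ f := by
  rw [diffHom, AddMonoidAlgebra.lift_apply, Finsupp.sum, LinearMap.sum_apply]
  rfl

lemma diffHom_X {n : ℕ} (i : Fin n) : diffHom n (X i) = (pderiv i).toLinearMap := by
  rw [diffHom, X, monomial]
  refine (AddMonoidAlgebra.lift_single _ _ _).trans ?_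
  rw [one_smul]
  change (List.ofFn fun j => (pderiv j).toLinearMap ^ (Finsupp.single i 1 : Fin n →₀ ℕ) j).prod = _
  rw [List.ofFn_eq_map, List.prod_map_eq_pow_single i _ fun j hj _ => by
    rw [Finsupp.single_eq_of_ne hj, pow_zero],
    List.count_eq_one_of_mem (List.nodup_finRange n) (List.mem_finRange i)]
  simp

lemma lap_eq {n : ℕ} (f : MvPolynomial (Fin n) ℂ) : lap f = diffHom n (qpoly n) f := by
  simp [lap, qpoly, diffHom_X, pow_two]

lemma isHomogeneous_qpoly (n : ℕ) : (qpoly n).IsHomogeneous 2 :=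
  IsHomogeneous.sum _ _ _ fun i _ => isHomogeneous_X_pow i 2

lemma pderiv_qpoly {n : ℕ} (i : Fin n) : pderiv i (qpoly n) = 2 * X i := by
  simp [qpoly, pderiv_X, Pi.single_apply]

lemma lap_pderiv {n : ℕ} (i : Fin n) {f : MvPolynomial (Fin n) ℂ} (hf : lap f = 0) :
    lap (pderiv i f) = 0 := by
  have h : diffHom n (qpoly n) (diffHom n (X i) f) = diffHom n (X i) (diffHom n (qpoly n) f) := by
    simp only [← Module.End.mul_apply, ← map_mul, mul_comm]
  rw [← lap_eq, ← lap_eq, hf, diffHom_X, map_zero] at h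
  exact h

lemma lap_qpoly_mul {n e : ℕ} {g : MvPolynomial (Fin n) ℂ} (hg : g.IsHomogeneous e) :
    lap (qpoly n * g) = qpoly n * lap g + ((2 * n + 4 * e : ℕ) : MvPolynomial (Fin n) ℂ) * g := by
  have h : ∀ i : Fin n, pderiv i (pderiv i (qpoly n * g)) =
      2 * g + 4 * (X i * pderiv i g) + qpoly n * pderiv i (pderiv i g) := by
    intro i
    have h2 : pderiv i (2 : MvPolynomial (Fin n) ℂ) = 0 := Derivation.map_natCast _ 2
    simp only [pderiv_mul, pderiv_qpoly, map_add, pderiv_X_self, h2]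
    ring
  simp only [lap, h, Finset.sum_add_distrib, ← Finset.mul_sum, hg.sum_X_mul_pderiv]
  simp
  ring

lemma lap_qpoly_pow_mul {n m : ℕ} {h : MvPolynomial (Fin n) ℂ} (hm : h.IsHomogeneous m)
    (hh : lap h = 0) (j : ℕ) :
    lap (qpoly n ^ (j + 1) * h) =
      ((2 * (j + 1) * (n + 2 * m + 2 * j) : ℕ) : ℂ) • (qpoly n ^ j * h) := by
  induction j with
  | zero =>
    rw [zero_add, pow_one, lap_qpoly_mul hm, hh, smul_eq_C_mul, map_natCast]
    push_cast
    ring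
  | succ j ih =>
    have hq : (qpoly n ^ (j + 1) * h).IsHomogeneous (2 * (j + 1) + m) :=
      ((isHomogeneous_qpoly n).pow _).mul hm
    rw [pow_succ', mul_assoc, lap_qpoly_mul hq, ih, smul_eq_C_mul, smul_eq_C_mul, map_natCast,
      map_natCast]
    push_cast
    ring

/-- A harmonic form applied to a power of the quadric. -/
lemma diffHom_harmonic_qpoly_pow {n : ℕ} (r m : ℕ) {h : MvPolynomial (Fin n) ℂ}
    (hm : h.IsHomogeneous m) (hh : lap h = 0) :
    diffHom n h (qpoly n ^ r) =
      ((2 ^ m * r.descFactorial m : ℕ) : ℂ) • (qpoly n ^ (r - m) * h) := by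
  induction m generalizing h with
  | zero =>
    obtain ⟨c, rfl⟩ : ∃ c, h = C c := ⟨_, totalDegree_eq_zero_iff_eq_C.1 (by
      simpa using hm.totalDegree_le)⟩
    rw [← algebraMap_eq, AlgHom.commutes]
    simp [Algebra.smul_def, mul_comm]
  | succ m ih =>
    have hd : ∀ i, (pderiv i h).IsHomogeneous m := fun i => hm.pderiv
    have key : ((m + 1 : ℕ) : ℂ) • diffHom n h (qpoly n ^ r) = ((m + 1 : ℕ) : ℂ) •
        (((2 ^ (m + 1) * r.descFactorial (m + 1) : ℕ) : ℂ) • (qpoly n ^ (r - (m + 1)) * h)) := by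
      have e1 : ((m + 1 : ℕ) : ℂ) • h = ∑ i, X i * pderiv i h := by
        rw [hm.sum_X_mul_pderiv, Nat.cast_smul_eq_nsmul]
      have e2 : ∀ i, pderiv i (qpoly n ^ (r - m) * pderiv i h) =
          2 * ((r - m : ℕ) : MvPolynomial (Fin n) ℂ) * qpoly n ^ (r - (m + 1)) *
            (X i * pderiv i h) + qpoly n ^ (r - m) * pderiv i (pderiv i h) := by
        intro i
        rw [pderiv_mul, pderiv_pow, pderiv_qpoly, Nat.sub_sub]
        ring
      have hh' : ∑ i, pderiv i (pderiv i h) = 0 := hh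
      rw [← LinearMap.smul_apply, ← map_smul, e1, map_sum, LinearMap.sum_apply]
      simp only [map_mul, Module.End.mul_apply, ih (hd _) (lap_pderiv _ hh), diffHom_X, map_smul,
        Derivation.coeFn_coe, e2]
      rw [← Finset.smul_sum, Finset.sum_add_distrib, ← Finset.mul_sum, ← Finset.mul_sum, hh', ← e1,
        Nat.descFactorial_succ]
      simp only [smul_eq_C_mul, map_natCast]
      push_cast
      ring
    exact smul_right_injective _ (by exact_mod_cast m.succ_ne_zero) key

lemma diffHom_qpoly_pow {n : ℕ} (hn : 1 ≤ n) {s j : ℕ} (hj : j ≤ s) :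
    ∃ c : ℂ, c ≠ 0 ∧ diffHom n (qpoly n ^ j) (qpoly n ^ s) = c • qpoly n ^ (s - j) := by
  induction j with
  | zero => exact ⟨1, one_ne_zero, by simp⟩
  | succ j ih =>
    obtain ⟨c, hc, h⟩ := ih (by omega)
    obtain ⟨t, ht⟩ : ∃ t, s - j = t + 1 := ⟨s - j - 1, by omega⟩
    have hl := lap_qpoly_pow_mul (isHomogeneous_one (Fin n) ℂ) (by simp [lap]) t
    rw [mul_one, mul_one] at hl
    refine ⟨c * ((2 * (t + 1) * (n + 2 * 0 + 2 * t) : ℕ) : ℂ), ?_, ?_⟩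
    · refine mul_ne_zero hc (Nat.cast_ne_zero.2 (Nat.mul_ne_zero ?_ ?_)) <;> omega
    · rw [pow_succ', map_mul, Module.End.mul_apply, h, map_smul, ← lap_eq, ht, hl, smul_smul,
        show s - (j + 1) = t by omega]

/-- Uniqueness of the decomposition into powers of the quadric times harmonic forms. -/
lemma eq_zero_of_sum_qpoly_pow_mul_eq_zero {n : ℕ} (hn : 1 ≤ n) (N : ℕ) (m : ℕ → ℕ)
    (g : ℕ → MvPolynomial (Fin n) ℂ) (hg : ∀ j, (g j).IsHomogeneous (m j) ∧ lap (g j) = 0)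
    (h : ∑ j ∈ Finset.range N, qpoly n ^ j * g j = 0) : ∀ j < N, g j = 0 := by
  induction N generalizing m g with
  | zero => simp
  | succ N ih =>
    rw [Finset.sum_range_succ'] at h
    have hl := congrArg (diffHom n (qpoly n)) h
    rw [map_add, map_sum, map_zero] at hl
    simp only [← lap_eq, lap_qpoly_pow_mul (hg _).1 (hg _).2, pow_zero, one_mul, (hg 0).2,
      add_zero, ← mul_smul_comm] at hl
    have hz : ∀ j < N, g (j + 1) = 0 := by
      intro j hj
      have := ih (fun j => m (j + 1)) (fun j => _ • g (j + 1)) (fun j => ⟨?_, ?_⟩) hl j hj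
      · refine (smul_eq_zero.1 this).resolve_left (Nat.cast_ne_zero.2 (Nat.mul_ne_zero ?_ ?_)) <;>
          omega
      · rw [smul_eq_C_mul]
        exact (hg _).1.C_mul _
      · rw [lap_eq, map_smul, ← lap_eq, (hg _).2, smul_zero]
    rw [Finset.sum_eq_zero fun j hj => by rw [hz j (Finset.mem_range.1 hj), mul_zero]] at h
    rintro (_ | j) hj
    · simpa using h
    · exact hz j (by omega)

lemma isHomogeneous_lap {n d : ℕ} {f : MvPolynomial (Fin n) ℂ} (hf : f.IsHomogeneous d) :
    (lap f).IsHomogeneous (d - 2) :=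
  IsHomogeneous.sum _ _ _ fun _ _ => hf.pderiv.pderiv

lemma lap_eq_zero_of_lt_two {n d : ℕ} (hd : d < 2) {f : MvPolynomial (Fin n) ℂ}
    (hf : f.IsHomogeneous d) : lap f = 0 := by
  refine Finset.sum_eq_zero fun i _ => ?_
  have h : (pderiv i f).IsHomogeneous 0 := by
    have := hf.pderiv (i := i)
    rwa [show d - 1 = 0 by omega] at this
  rw [totalDegree_eq_zero_iff_eq_C.1 (Nat.le_zero.1 h.totalDegree_le), pderiv_C]

/-- Existence of the decomposition into powers of the quadric times harmonic forms. -/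
lemma exists_harmonic_decomposition {n : ℕ} (hn : 1 ≤ n) (d : ℕ) (f : MvPolynomial (Fin n) ℂ)
    (hf : f.IsHomogeneous d) : ∃ h : ℕ → MvPolynomial (Fin n) ℂ,
      (∀ j, (h j).IsHomogeneous (d - 2 * j) ∧ lap (h j) = 0) ∧
        f = ∑ j ∈ Finset.range (d / 2 + 1), qpoly n ^ j * h j := by
  induction d using Nat.strong_induction_on generalizing f with
  | _ d ih =>
    by_cases hd : d < 2
    · refine ⟨fun j => if j = 0 then f else 0, fun j => ?_, ?_⟩
      · dsimp only
        split_ifs with hj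
        · subst hj
          exact ⟨hf, lap_eq_zero_of_lt_two hd hf⟩
        · exact ⟨isHomogeneous_zero _ _ _, by simp [lap]⟩
      · simp [show d / 2 = 0 by omega]
    · obtain ⟨e, rfl⟩ : ∃ e, d = e + 2 := ⟨d - 2, by omega⟩
      obtain ⟨g, hg, hfg⟩ := ih e (by omega) (lap f) (isHomogeneous_lap hf)
      let c : ℕ → ℕ := fun j => 2 * (j + 1) * (n + 2 * (e - 2 * j) + 2 * j)
      have hc : ∀ j, (c j : ℂ) ≠ 0 := fun j =>
        Nat.cast_ne_zero.2 (Nat.mul_ne_zero (by omega) (by omega))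
      let u : ℕ → MvPolynomial (Fin n) ℂ := fun j => (c j : ℂ)⁻¹ • g j
      have hu : ∀ j, (u j).IsHomogeneous (e - 2 * j) ∧ lap (u j) = 0 := fun j => by
        constructor
        · simp only [u, smul_eq_C_mul]
          exact (hg j).1.C_mul _
        · simp only [u]
          rw [lap_eq, map_smul, ← lap_eq, (hg j).2, smul_zero]
      let F := ∑ j ∈ Finset.range (e / 2 + 1), qpoly n ^ (j + 1) * u j
      have hF : F.IsHomogeneous (e + 2) := by
        refine IsHomogeneous.sum _ _ _ fun j hj => ?_
        have := ((isHomogeneous_qpoly n).pow (j + 1)).mul (hu j).1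
        rw [Finset.mem_range] at hj
        rwa [show 2 * (j + 1) + (e - 2 * j) = e + 2 by omega] at this
      have hlF : lap F = lap f := by
        rw [hfg, lap_eq, map_sum]
        refine Finset.sum_congr rfl fun j _ => ?_
        rw [← lap_eq, lap_qpoly_pow_mul (hu j).1 (hu j).2, ← mul_smul_comm]
        congr 1
        exact smul_inv_smul₀ (hc j) _
      refine ⟨fun j => Nat.casesOn j (f - F) u, ?_, ?_⟩
      · rintro (_ | j)
        · refine ⟨hf.sub hF, ?_⟩
          change lap (f - F) = 0
          rw [lap_eq, map_sub, ← lap_eq, ← lap_eq, hlF, sub_self]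
        · rw [show e + 2 - 2 * (j + 1) = e - 2 * j by omega]
          exact hu j
      · rw [show (e + 2) / 2 + 1 = (e / 2 + 1) + 1 by omega, Finset.sum_range_succ']
        change f = F + qpoly n ^ 0 * (f - F)
        ring

/-- The action of a decomposition summand on a power of the quadric. -/
lemma diffHom_summand {n : ℕ} (hn : 1 ≤ n) {s j m : ℕ} (hj : j ≤ s)
    {h : MvPolynomial (Fin n) ℂ} (hm : h.IsHomogeneous m) (hh : lap h = 0) :
    ∃ c : ℂ, (c = 0 ↔ s - j < m) ∧
      diffHom n (qpoly n ^ j * h) (qpoly n ^ s) = c • (qpoly n ^ (s - j - m) * h) := by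
  obtain ⟨c, hc, hcs⟩ := diffHom_qpoly_pow hn hj
  refine ⟨c * ((2 ^ m * (s - j).descFactorial m : ℕ) : ℂ), ?_, ?_⟩
  · simp [hc, Nat.descFactorial_eq_zero_iff_lt]
  · rw [mul_comm (qpoly n ^ j), map_mul, Module.End.mul_apply, hcs, map_smul,
      diffHom_harmonic_qpoly_pow _ _ hm hh, smul_smul]

lemma exists_decomposition_of_mem_ann {n s k : ℕ} (hn : 1 ≤ n) (hk : k ≤ s + 1)
    {φ : MvPolynomial (Fin n) ℂ} (hφ : φ.IsHomogeneous (s + k))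
    (h0 : diffHom n φ (qpoly n ^ s) = 0) : ∃ h : ℕ → MvPolynomial (Fin n) ℂ,
      (∀ j, (h j).IsHomogeneous (s + k - 2 * j) ∧ lap (h j) = 0) ∧
        φ = ∑ j ∈ Finset.range k, qpoly n ^ j * h j := by
  obtain ⟨h, hh, hsum⟩ := exists_harmonic_decomposition hn _ φ hφ
  refine ⟨h, hh, ?_⟩
  obtain ⟨N, hN⟩ : ∃ N, (s + k) / 2 + 1 = k + N := ⟨(s + k) / 2 + 1 - k, by omega⟩
  have hc : ∀ j, ∃ c : ℂ, j < k + N → (c = 0 ↔ j < k) ∧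
      diffHom n (qpoly n ^ j * h j) (qpoly n ^ s) = c • (qpoly n ^ (j - k) * h j) := by
    intro j
    by_cases hj : j < k + N
    · obtain ⟨c, hc, hd⟩ := diffHom_summand hn (show j ≤ s by omega) (hh j).1 (hh j).2
      refine ⟨c, fun _ => ⟨hc.trans (by omega), ?_⟩⟩
      rw [hd, show s - j - (s + k - 2 * j) = j - k by omega]
    · exact ⟨0, fun h => absurd h hj⟩
  choose c hc using hc
  rw [hN] at hsum
  rw [hsum, map_sum, LinearMap.sum_apply, Finset.sum_congr rfl fun j hj =>
    (hc j (Finset.mem_range.1 hj)).2, Finset.sum_range_add, Finset.sum_eq_zero fun j hj => by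
      have hj := Finset.mem_range.1 hj
      rw [(hc j (by omega)).1.2 hj, zero_smul], zero_add] at h0
  simp only [Nat.add_sub_cancel_left, ← mul_smul_comm] at h0
  have hz := eq_zero_of_sum_qpoly_pow_mul_eq_zero hn N (fun j => s + k - 2 * (k + j))
    (fun j => c (k + j) • h (k + j)) (fun j => ⟨by
      rw [smul_eq_C_mul]
      exact (hh _).1.C_mul _, by
      rw [lap_eq, map_smul, ← lap_eq, (hh _).2, smul_zero]⟩) h0
  rw [hsum, Finset.sum_range_add, add_eq_left]
  refine Finset.sum_eq_zero fun j hj => ?_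
  have hj := Finset.mem_range.1 hj
  rw [(smul_eq_zero.1 (hz j hj)).resolve_left fun h => ?_, mul_zero]
  have := (hc (k + j) (by omega)).1.1 h
  omega

/-- For n ≥ 1, s ≥ 1: (1) for 0 ≤ d ≤ s the degree-d graded component of
Ann(q_n^s) is zero; (2) for 1 ≤ k ≤ s+1 the degree-(s+k) component of Ann(q_n^s) equals
the direct sum ⊕_{j=0}^{k-1} q_n^j · H_{n,s+k-2j} (directness expressed by uniqueness). -/
theorem apolar_components_of_power_of_quadric (n s : ℕ) (hn : 1 ≤ n) (hs : 1 ≤ s) :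
    (∀ d : ℕ, d ≤ s → ∀ φ : MvPolynomial (Fin n) ℂ,
        φ.IsHomogeneous d → diffOp φ (qpoly n ^ s) = 0 → φ = 0) ∧
    (∀ k : ℕ, 1 ≤ k → k ≤ s + 1 → ∀ φ : MvPolynomial (Fin n) ℂ,
        (φ.IsHomogeneous (s + k) ∧ diffOp φ (qpoly n ^ s) = 0) ↔
          ∃! h : Fin k → MvPolynomial (Fin n) ℂ,
            (∀ j : Fin k, (h j).IsHomogeneous (s + k - 2 * (j : ℕ)) ∧ lap (h j) = 0) ∧
              φ = ∑ j : Fin k, qpoly n ^ (j : ℕ) * h j) := by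
  refine ⟨fun d hd φ hφ h0 => ?_, fun k _ hk φ => ⟨fun ⟨hφ, h0⟩ => ?_, ?_⟩⟩
  · rw [diffOp_eq] at h0
    let p : MvPolynomial (Fin n) ℂ := X ⟨0, hn⟩ ^ (s - d)
    have hp : (p * φ).IsHomogeneous (s + 0) := by
      have := (isHomogeneous_X_pow (R := ℂ) (⟨0, hn⟩ : Fin n) (s - d)).mul hφ
      rwa [show s - d + d = s + 0 by omega] at this
    obtain ⟨h, -, hs⟩ := exists_decomposition_of_mem_ann hn (by omega) hp (by
      rw [map_mul, Module.End.mul_apply, h0, map_zero])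
    rw [Finset.range_zero, Finset.sum_empty] at hs
    exact (mul_eq_zero.1 hs).resolve_left (pow_ne_zero _ (X_ne_zero _))
  · rw [diffOp_eq] at h0
    obtain ⟨h, hh, hsum⟩ := exists_decomposition_of_mem_ann hn hk hφ h0
    refine ⟨fun j => h j, ⟨fun j => hh j, ?_⟩, ?_⟩
    · rw [hsum, Finset.sum_range]
    · rintro g ⟨hg, hgs⟩
      let u : ℕ → MvPolynomial (Fin n) ℂ := fun j => if hj : j < k then g ⟨j, hj⟩ - h j else 0
      have hz := eq_zero_of_sum_qpoly_pow_mul_eq_zero hn k (fun j => s + k - 2 * j) u (fun j => by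
        simp only [u]
        split_ifs with hj
        · refine ⟨(hg _).1.sub (hh _).1, ?_⟩
          rw [lap_eq, map_sub, ← lap_eq, ← lap_eq, (hg _).2, (hh _).2, sub_zero]
        · exact ⟨isHomogeneous_zero _ _ _, by simp [lap]⟩) (by
        rw [Finset.sum_range]
        simp only [u, Fin.is_lt, dif_pos, mul_sub, Finset.sum_sub_distrib]
        rw [← hgs, hsum, Finset.sum_range, sub_self])
      ext1 j
      have := hz j j.2
      simpa [u, sub_eq_zero] using this
  · rintro ⟨h, ⟨hh, rfl⟩, -⟩
    constructor
    · refine IsHomogeneous.sum _ _ _ fun j _ => ?_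
      have := ((isHomogeneous_qpoly n).pow j).mul (hh j).1
      rwa [show 2 * (j : ℕ) + (s + k - 2 * j) = s + k by omega] at this
    · rw [diffOp_eq, map_sum, LinearMap.sum_apply]
      refine Finset.sum_eq_zero fun j _ => ?_
      obtain ⟨c, hc, hd⟩ := diffHom_summand hn (show (j : ℕ) ≤ s by omega) (hh j).1 (hh j).2
      rw [hd, hc.2 (by omega), zero_smul]
end

section
/- For all integers n ≥ 1 and s ≥ 1, the Waring rank of q_n^s satisfies rk(q_n^s) ≥ binom(s+n−1, n−1). -/
open MvPolynomial

noncomputable def waringRank (n d : ℕ) (f : MvPolynomial (Fin n) ℂ) : ℕ :=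
  sInf {r : ℕ | ∃ a : Fin r → Fin n → ℂ, f = ∑ k : Fin r, linForm (a k) ^ d}

open MeasureTheory

/-- A functional vanishing on `d`-th powers of all real linear forms vanishes in degree `d`. -/
theorem map_eq_zero_of_map_linForm_pow_eq_zero {n d : ℕ} (l : MvPolynomial (Fin n) ℂ →ₗ[ℂ] ℂ)
    (h : ∀ a : Fin n → ℝ, l (linForm (fun i => (a i : ℂ)) ^ d) = 0)
    {p : MvPolynomial (Fin n) ℂ} (hp : p.IsHomogeneous d) : l p = 0 := by
  classical
  have hexp (a : Fin n → ℂ) : l (linForm a ^ d) = ∑ k ∈ Finset.univ.piAntidiag d,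
      (Nat.multinomial Finset.univ k * l (monomial (Finsupp.equivFunOnFinite.symm k) 1)) *
        ∏ i, a i ^ k i := by
    rw [linForm, Finset.sum_pow_eq_sum_piAntidiag, map_sum]
    refine Finset.sum_congr rfl fun k _ => ?_
    have : (Nat.multinomial Finset.univ k : MvPolynomial (Fin n) ℂ) * ∏ i, (C (a i) * X i) ^ k i =
        (Nat.multinomial Finset.univ k * ∏ i, a i ^ k i : ℂ) •
          monomial (Finsupp.equivFunOnFinite.symm k) 1 := by
      rw [monomial_eq, Finsupp.prod_fintype _ _ (by simp), smul_eq_C_mul]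
      simp [mul_pow, Finset.prod_mul_distrib, mul_assoc]
    rw [this, map_smul, smul_eq_mul]
    ring
  let P : MvPolynomial (Fin n) ℂ := ∑ k ∈ Finset.univ.piAntidiag d,
    monomial (Finsupp.equivFunOnFinite.symm k)
      (Nat.multinomial Finset.univ k * l (monomial (Finsupp.equivFunOnFinite.symm k) 1))
  have hP : P = 0 := by
    refine funext_set (fun _ => Set.range ((↑) : ℝ → ℂ))
      (fun _ => Set.infinite_range_of_injective Complex.ofReal_injective) fun x hx => ?_
    choose a ha using fun i => hx i (Set.mem_univ i)
    obtain rfl : (fun i => (a i : ℂ)) = x := _root_.funext ha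
    rw [map_zero, ← h a, hexp, map_sum]
    refine Finset.sum_congr rfl fun k _ => ?_
    rw [eval_monomial, Finsupp.prod_fintype _ _ (by simp)]
    simp
  have hmon (m : Fin n →₀ ℕ) (hm : m.degree = d) : l (monomial m 1) = 0 := by
    have hc := congrArg (coeff m) hP
    rw [coeff_sum, Finset.sum_eq_single (m : Fin n → ℕ)] at hc
    · have h0 : (Nat.multinomial Finset.univ m : ℂ) ≠ 0 :=
        Nat.cast_ne_zero.2 (Nat.multinomial_pos _ _).ne'
      simpa [h0] using hc
    · intro k _ hk
      rw [coeff_monomial, if_neg]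
      rintro rfl
      exact hk rfl
    · intro hm'
      exact absurd (by simpa [Finsupp.degree_eq_sum] using hm) hm'
  rw [p.as_sum, map_sum]
  refine Finset.sum_eq_zero fun m hm => ?_
  have : monomial m (coeff m p) = coeff m p • (monomial m 1 : MvPolynomial (Fin n) ℂ) := by
    simp [smul_monomial]
  rw [this, map_smul, hmon m, smul_zero]
  exact (hp.degree_eq_sum_deg_support hm).symm

theorem exists_eq_sum_linForm_pow {n d : ℕ} (hd : d ≠ 0) {p : MvPolynomial (Fin n) ℂ}
    (hp : p.IsHomogeneous d) :
    ∃ r : ℕ, ∃ a : Fin r → Fin n → ℂ, p = ∑ k, linForm (a k) ^ d := by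
  have hmem : p ∈ Submodule.span ℂ (Set.range fun a : Fin n → ℂ => linForm a ^ d) := by
    by_contra hnot
    obtain ⟨l, hlp, hl⟩ := Submodule.exists_le_ker_of_notMem hnot
    exact hlp (map_eq_zero_of_map_linForm_pow_eq_zero l
      (fun a => hl (Submodule.subset_span ⟨_, rfl⟩)) hp)
  obtain ⟨r, c, g, rfl⟩ := Submodule.mem_span_set'.1 hmem
  choose b hb using fun k => (g k).2
  choose w hw using fun k => IsAlgClosed.exists_pow_nat_eq (c k) (Nat.pos_of_ne_zero hd)
  refine ⟨r, fun k => w k • b k, Finset.sum_congr rfl fun k _ => ?_⟩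
  have : linForm (w k • b k) = C (w k) * linForm (b k) := by
    simp [linForm, Finset.mul_sum, mul_assoc]
  rw [this, mul_pow, ← map_pow, hw, ← hb, smul_eq_C_mul]

theorem exists_isHomogeneous_eval_eq_zero {n s r : ℕ} (hr : r < (n + s - 1).choose s)
    (a : Fin r → Fin n → ℂ) :
    ∃ p : MvPolynomial (Fin n) ℂ, p.IsHomogeneous s ∧ p ≠ 0 ∧ ∀ k, eval (a k) p = 0 := by
  classical
  let S := (Finset.univ : Finset (Fin n)).finsuppAntidiag s
  let F : (S → ℂ) →ₗ[ℂ] MvPolynomial (Fin n) ℂ :=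
    ∑ m : S, (monomial (m : Fin n →₀ ℕ)).comp (LinearMap.proj m)
  let E : MvPolynomial (Fin n) ℂ →ₗ[ℂ] Fin r → ℂ :=
    LinearMap.pi fun k => (aeval (a k)).toLinearMap
  have hF (c : S → ℂ) : F c = ∑ m : S, monomial (m : Fin n →₀ ℕ) (c m) := by simp [F]
  have hker : LinearMap.ker (E ∘ₗ F) ≠ ⊥ := by
    apply LinearMap.ker_ne_bot_of_finrank_lt
    simpa [S, Finset.card_finsuppAntidiag_nat_eq_choose] using hr
  obtain ⟨c, hc, hc0⟩ := Submodule.exists_mem_ne_zero_of_ne_bot hker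
  refine ⟨F c, ?_, fun h0 => hc0 ?_, fun k => ?_⟩
  · rw [hF]
    refine IsHomogeneous.sum _ _ _ fun m _ => isHomogeneous_monomial _ ?_
    exact (Finset.mem_finsuppAntidiag'.1 m.2).1
  · ext m
    have := congrArg (coeff (m : Fin n →₀ ℕ)) h0
    simpa [hF, coeff_sum, coeff_monomial, Subtype.coe_inj] using this
  · simpa [E, aeval_eq_eval] using congrFun (LinearMap.mem_ker.1 hc) k

theorem continuous_eval_ofReal {n : ℕ} (p : MvPolynomial (Fin n) ℂ) :
    Continuous fun x : EuclideanSpace ℝ (Fin n) => eval (fun i => (x i : ℂ)) p :=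
  p.continuous_eval.comp (by fun_prop)

theorem integrableOn_ball_eval {n : ℕ} (p : MvPolynomial (Fin n) ℂ) :
    IntegrableOn (fun x : EuclideanSpace ℝ (Fin n) => eval (fun i => (x i : ℂ)) p)
      (Metric.ball 0 1) :=
  ((continuous_eval_ofReal p).continuousOn.integrableOn_compact
    (isCompact_closedBall 0 1)).mono_set Metric.ball_subset_closedBall

noncomputable def ballIntegral (n : ℕ) : MvPolynomial (Fin n) ℂ →ₗ[ℂ] ℂ where
  toFun p := ∫ x : EuclideanSpace ℝ (Fin n) in Metric.ball 0 1, eval (fun i => (x i : ℂ)) p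
  map_add' p q := by
    simp only [map_add]
    exact integral_add (integrableOn_ball_eval p) (integrableOn_ball_eval q)
  map_smul' c p := by
    simp only [smul_eval, RingHom.id_apply, smul_eq_mul]
    exact integral_const_mul _ _

theorem integral_ball_inner_pow_eq {E : Type*} [NormedAddCommGroup E] [InnerProductSpace ℝ E]
    [FiniteDimensional ℝ E] [MeasurableSpace E] [BorelSpace E] {v w : E} (h : ‖v‖ = ‖w‖) (d : ℕ) :
    ∫ x in Metric.ball (0 : E) 1, inner ℝ v x ^ d = ∫ x in Metric.ball (0 : E) 1, inner ℝ w x ^ d := by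
  let R := (ℝ ∙ (v - w))ᗮ.reflection
  have hR : R v = w := Submodule.reflection_sub h
  have := R.measurePreserving.setIntegral_preimage_emb
    R.toHomeomorph.measurableEmbedding (fun x => inner ℝ w x ^ d) (Metric.ball 0 1)
  rw [R.preimage_ball, map_zero] at this
  rw [← this]
  simp_rw [← hR, R.inner_map_map]

/-- Moments of the unit ball along real directions are proportional to powers of the quadric. -/
theorem exists_ballIntegral_linForm_pow {n : ℕ} (hn : 0 < n) (s : ℕ) : ∃ c : ℂ, ∀ a : Fin n → ℝ,
    ballIntegral n (linForm (fun i => (a i : ℂ)) ^ (2 * s)) =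
      c * eval (fun i => (a i : ℂ)) (qpoly n ^ s) := by
  have key (a : Fin n → ℝ) : ballIntegral n (linForm (fun i => (a i : ℂ)) ^ (2 * s)) =
      ((∫ x in Metric.ball (0 : EuclideanSpace ℝ (Fin n)) 1,
        inner ℝ (WithLp.toLp 2 a) x ^ (2 * s) : ℝ) : ℂ) := by
    rw [← integral_complex_ofReal]
    refine integral_congr_ae (.of_forall fun x => ?_)
    simp [linForm, PiLp.inner_apply, mul_comm]
  have hq (a : Fin n → ℝ) : eval (fun i => (a i : ℂ)) (qpoly n ^ s) =
      ((‖WithLp.toLp 2 a‖ ^ (2 * s) : ℝ) : ℂ) := by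
    rw [pow_mul, EuclideanSpace.real_norm_sq_eq]
    simp [qpoly]
  let e : EuclideanSpace ℝ (Fin n) := EuclideanSpace.single ⟨0, hn⟩ 1
  refine ⟨((∫ x in Metric.ball (0 : EuclideanSpace ℝ (Fin n)) 1,
    inner ℝ e x ^ (2 * s) : ℝ) : ℂ), fun a => ?_⟩
  rw [key, hq, integral_ball_inner_pow_eq (w := ‖WithLp.toLp 2 a‖ • e) (by simp [e, norm_smul])]
  simp_rw [inner_smul_left, mul_pow, integral_const_mul]
  simp [mul_comm]

theorem eq_zero_of_ballIntegral_mul_conj_eq_zero {n : ℕ} {p : MvPolynomial (Fin n) ℂ}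
    (h : ballIntegral n (p * map (starRingEnd ℂ) p) = 0) : p = 0 := by
  have hconj (x : EuclideanSpace ℝ (Fin n)) :
      eval (fun i => (x i : ℂ)) (p * map (starRingEnd ℂ) p) =
        ((‖eval (fun i => (x i : ℂ)) p‖ ^ 2 : ℝ) : ℂ) := by
    have : eval (fun i => (x i : ℂ)) (map (starRingEnd ℂ) p) =
        starRingEnd ℂ (eval (fun i => (x i : ℂ)) p) := by
      rw [eval_map, ← eval₂_id, hom_eval₂]
      simp
    rw [map_mul, this, Complex.mul_conj']
    simp
  have hcont := continuous_eval_ofReal p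
  have hint : ∫ x : EuclideanSpace ℝ (Fin n) in Metric.ball 0 1,
      ‖eval (fun i => (x i : ℂ)) p‖ ^ 2 = 0 := by
    have h' : ∫ x : EuclideanSpace ℝ (Fin n) in Metric.ball 0 1,
        eval (fun i => (x i : ℂ)) (p * map (starRingEnd ℂ) p) = 0 := h
    simp_rw [hconj] at h'
    rw [integral_complex_ofReal] at h'
    exact_mod_cast h'
  have hsq : Continuous fun x : EuclideanSpace ℝ (Fin n) =>
      ‖eval (fun i => (x i : ℂ)) p‖ ^ 2 := hcont.norm.pow 2
  rw [setIntegral_eq_zero_iff_of_nonneg_ae (.of_forall fun x => by positivity)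
    ((hsq.continuousOn.integrableOn_compact
      (isCompact_closedBall 0 1)).mono_set Metric.ball_subset_closedBall)] at hint
  have hzero := Measure.eqOn_open_of_ae_eq hint Metric.isOpen_ball
    hsq.continuousOn continuousOn_const
  have hopen : IsOpen ((WithLp.toLp 2 : (Fin n → ℝ) → EuclideanSpace ℝ (Fin n)) ⁻¹'
      Metric.ball 0 1) := Metric.isOpen_ball.preimage (by fun_prop)
  obtain ⟨ε, hε, hball⟩ := Metric.isOpen_iff.1 hopen 0 (by simp)
  refine funext_set (fun _ => (fun t : ℝ => (t : ℂ)) '' Metric.ball 0 ε)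
    (fun _ => Set.Infinite.image Complex.ofReal_injective.injOn
      (infinite_of_mem_nhds 0 (Metric.ball_mem_nhds 0 hε))) fun x hx => ?_
  choose a ha hax using fun i => hx i (Set.mem_univ i)
  obtain rfl : (fun i => (a i : ℂ)) = x := _root_.funext hax
  have := hzero (hball (show a ∈ Metric.ball 0 ε by
    simpa [ball_pi _ hε] using ha))
  simpa using this

theorem choose_le_of_qpoly_pow_eq_sum_linForm_pow {n s r : ℕ} (hn : 0 < n)
    (a : Fin r → Fin n → ℂ) (ha : qpoly n ^ s = ∑ k, linForm (a k) ^ (2 * s)) :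
    (n + s - 1).choose s ≤ r := by
  by_contra! hlt
  obtain ⟨p, hp, hp0, hpa⟩ := exists_isHomogeneous_eval_eq_zero hlt a
  obtain ⟨c, hc⟩ := exists_ballIntegral_linForm_pow hn s
  let l := ballIntegral n - c • ∑ k, (aeval (a k)).toLinearMap
  have hl (q : MvPolynomial (Fin n) ℂ) : l q = ballIntegral n q - c * ∑ k, eval (a k) q := by
    simp [l, aeval_eq_eval]
  refine hp0 (eq_zero_of_ballIntegral_mul_conj_eq_zero ?_)
  have hzero : l (p * map (starRingEnd ℂ) p) = 0 := by
    refine map_eq_zero_of_map_linForm_pow_eq_zero (d := 2 * s) l (fun z => ?_) ?_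
    · rw [hl, hc, ha, map_sum, sub_eq_zero]
      simp [linForm, mul_comm]
    · rw [two_mul]
      exact hp.mul (hp.map _)
  simpa [hl, hpa] using hzero

/-- For all n ≥ 1 and s ≥ 1, rk(q_n^s) ≥ binom(s+n−1, n−1). -/
theorem waringRank_power_of_quadric_lower_bound (n s : ℕ) (hn : 1 ≤ n) (hs : 1 ≤ s) :
    (s + n - 1).choose (n - 1) ≤ waringRank n (2 * s) (qpoly n ^ s) := by
  have hq : (qpoly n ^ s).IsHomogeneous (2 * s) :=
    (IsHomogeneous.sum _ _ _ fun i _ => isHomogeneous_X_pow i 2).pow s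
  refine le_csInf (exists_eq_sum_linForm_pow (by lia) hq) ?_
  rintro r ⟨a, ha⟩
  rw [← Nat.choose_symm_of_eq_add (show s + n - 1 = s + (n - 1) by lia), add_comm s n]
  exact choose_le_of_qpoly_pow_eq_sum_linForm_pow hn a ha
end

section
/- Let n ≥ 1 and d ≥ 2. Then: (1) for a point a ∈ ℂ^n, the power (a·x)^d of the associated linear form is harmonic if and only if a·a = 0; and (2) the space H_{n,d} of degree-d homogeneous harmonic polynomials is spanned over ℂ by the set { (a·x)^d : a ∈ ℂ^n, a·a = 0 }. -/
open MvPolynomial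

theorem pderiv_linForm {n : ℕ} (a : Fin n → ℂ) (i : Fin n) :
    pderiv i (linForm a) = C (a i) := by
  classical
  simp [linForm, pderiv_X, Pi.single_apply]

theorem lap_linForm_pow {n : ℕ} (a : Fin n → ℂ) (k : ℕ) :
    lap (linForm a ^ (k + 2)) =
      C (((k : ℂ) + 2) * ((k : ℂ) + 1) * dotC a a) * linForm a ^ k := by
  have h (i : Fin n) : pderiv i (pderiv i (linForm a ^ (k + 2))) =
      C (((k : ℂ) + 2) * ((k : ℂ) + 1)) * linForm a ^ k * C (a i * a i) := by
    have hc : C (k : ℂ) = (k : MvPolynomial (Fin n) ℂ) := map_natCast C k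
    have h2 : C (2 : ℂ) = (2 : MvPolynomial (Fin n) ℂ) := map_ofNat C 2
    rw [pderiv_pow, pderiv_linForm, Derivation.leibniz, Derivation.leibniz]
    simp only [pderiv_C, add_tsub_cancel_right, Nat.add_succ_sub_one,
      pderiv_pow, pderiv_linForm, Derivation.map_natCast, smul_eq_mul]
    push_cast
    simp only [map_mul, map_add, hc, h2, map_one]
    ring
  rw [lap, Finset.sum_congr rfl fun i _ => h i, ← Finset.mul_sum, ← map_sum, dotC,
    map_mul C (_ * _)]
  ring

theorem linForm_eq_zero {n : ℕ} {a : Fin n → ℂ} (h : linForm a = 0) : a = 0 := by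
  funext i
  have := pderiv_linForm a i
  rw [h, map_zero] at this
  simpa using this.symm

theorem lap_linForm_pow_eq_zero_iff {n d : ℕ} (hd : 2 ≤ d) (a : Fin n → ℂ) :
    lap (linForm a ^ d) = 0 ↔ dotC a a = 0 := by
  obtain ⟨k, rfl⟩ := Nat.exists_eq_add_of_le' hd
  rw [lap_linForm_pow]
  refine ⟨fun h => ?_, fun h => by simp [h]⟩
  rcases mul_eq_zero.mp h with h | h
  · have h1 : ((k : ℂ) + 2) ≠ 0 := by exact_mod_cast (by omega : k + 2 ≠ 0)
    have h2 : ((k : ℂ) + 1) ≠ 0 := by exact_mod_cast (by omega : k + 1 ≠ 0)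
    rw [C_eq_zero] at h
    simpa [h1, h2] using h
  · rw [linForm_eq_zero (eq_zero_of_pow_eq_zero h)]
    simp [dotC]

theorem linForm_isHomogeneous {n : ℕ} (a : Fin n → ℂ) : (linForm a).IsHomogeneous 1 :=
  IsHomogeneous.sum _ _ _ fun i _ => by
    simpa using (isHomogeneous_C (Fin n) (a i)).mul (isHomogeneous_X ℂ i)

/-- The subspace of harmonic homogeneous polynomials of degree `d`. -/
noncomputable def harmonicSubmodule (n d : ℕ) : Submodule ℂ (MvPolynomial (Fin n) ℂ) where
  carrier := {h | h.IsHomogeneous d ∧ lap h = 0}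
  zero_mem' := ⟨isHomogeneous_zero _ _ _, by simp [lap]⟩
  add_mem' := fun {p q} hp hq => ⟨hp.1.add hq.1, by
    have : lap (p + q) = lap p + lap q := by simp [lap, Finset.sum_add_distrib]
    rw [this, hp.2, hq.2, add_zero]⟩
  smul_mem' := fun c p hp => ⟨by
    rw [smul_eq_C_mul]
    simpa using (isHomogeneous_C (Fin n) c).mul hp.1, by
    have : lap (c • p) = c • lap p := by simp [lap, Finset.smul_sum]
    rw [this, hp.2, smul_zero]⟩

/-- The apolar pairing with `h`, sending a monomial `X ^ α` to `α!` times the coefficient of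
`X ^ α` in `h`. -/
noncomputable def apolarPairing {n : ℕ} (h : MvPolynomial (Fin n) ℂ) :
    MvPolynomial (Fin n) ℂ →ₗ[ℂ] ℂ :=
  (basisMonomials (Fin n) ℂ).constr ℂ fun α => ((∏ j, (α j).factorial : ℕ) : ℂ) * coeff α h

theorem apolarPairing_monomial {n : ℕ} (h : MvPolynomial (Fin n) ℂ) (α : Fin n →₀ ℕ) (c : ℂ) :
    apolarPairing h (monomial α c) = c * (((∏ j, (α j).factorial : ℕ) : ℂ) * coeff α h) := by
  have : monomial α c = c • basisMonomials (Fin n) ℂ α := by simp [smul_monomial]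
  rw [this, map_smul, apolarPairing, Module.Basis.constr_basis, smul_eq_mul]

theorem apolarPairing_zero {n : ℕ} : apolarPairing (0 : MvPolynomial (Fin n) ℂ) = 0 :=
  (basisMonomials (Fin n) ℂ).ext fun α => by simp [apolarPairing_monomial]

theorem apolarPairing_X_mul {n : ℕ} (h φ : MvPolynomial (Fin n) ℂ) (i : Fin n) :
    apolarPairing h (X i * φ) = apolarPairing (pderiv i h) φ := by
  induction φ using MvPolynomial.induction_on' with
  | add p q hp hq => rw [mul_add, map_add, map_add, hp, hq]
  | monomial α c =>
    classical
    rw [mul_comm, ← pow_one (X i), ← monomial_add_single, apolarPairing_monomial,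
      apolarPairing_monomial, coeff_pderiv]
    have : ∏ j, ((α + Finsupp.single i 1 : Fin n →₀ ℕ) j).factorial =
        (α i + 1) * ∏ j, (α j).factorial := by
      rw [← Finset.mul_prod_erase _ _ (Finset.mem_univ i),
        ← Finset.mul_prod_erase _ (fun j => (α j).factorial) (Finset.mem_univ i)]
      have h2 : ∏ j ∈ Finset.univ.erase i, ((α + Finsupp.single i 1 : Fin n →₀ ℕ) j).factorial =
          ∏ j ∈ Finset.univ.erase i, (α j).factorial :=
        Finset.prod_congr rfl fun j hj => by
          simp [(Finset.ne_of_mem_erase hj).symm]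
      rw [h2]
      simp [Nat.factorial_succ, mul_assoc]
    rw [this]
    push_cast
    ring

theorem apolarPairing_qpoly_mul {n : ℕ} (h φ : MvPolynomial (Fin n) ℂ) (hh : lap h = 0) :
    apolarPairing h (qpoly n * φ) = 0 := by
  have key : apolarPairing h (qpoly n * φ) = apolarPairing (lap h) φ := by
    have hadd : apolarPairing (lap h) φ =
        ∑ i, apolarPairing (pderiv i (pderiv i h)) φ := by
      induction φ using MvPolynomial.induction_on' with
      | add p q hp hq => simp only [map_add, hp, hq, Finset.sum_add_distrib]
      | monomial α c =>
        simp only [apolarPairing_monomial, lap, coeff_sum, Finset.mul_sum]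
    simp only [hadd, qpoly, Finset.sum_mul, map_sum, pow_two, mul_assoc, apolarPairing_X_mul]
  rw [key, hh, apolarPairing_zero, LinearMap.zero_apply]

theorem qpoly_succ (m : ℕ) :
    qpoly (m + 1) = X 0 ^ 2 + rename Fin.succ (qpoly m) := by
  simp [qpoly, Fin.sum_univ_succ]

/-- Division with remainder by `qpoly` with respect to the first variable. -/
theorem exists_eq_qpoly_mul_add {m : ℕ} (f : MvPolynomial (Fin (m + 1)) ℂ) :
    ∃ (g : MvPolynomial (Fin (m + 1)) ℂ) (A B : MvPolynomial (Fin m) ℂ),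
      f = qpoly (m + 1) * g + (rename Fin.succ A * X 0 + rename Fin.succ B) := by
  induction f using MvPolynomial.induction_on with
  | C c => exact ⟨0, 0, C c, by simp⟩
  | add p q hp hq =>
    obtain ⟨g, A, B, rfl⟩ := hp
    obtain ⟨g', A', B', rfl⟩ := hq
    exact ⟨g + g', A + A', B + B', by simp only [map_add]; ring⟩
  | mul_X p i hp =>
    obtain ⟨g, A, B, rfl⟩ := hp
    cases i using Fin.cases with
    | zero =>
      refine ⟨g * X 0 + rename Fin.succ A, B, -(A * qpoly m), ?_⟩
      rw [qpoly_succ]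
      simp only [map_neg, map_mul]
      ring
    | succ j =>
      refine ⟨g * X j.succ, A * X j, B * X j, ?_⟩
      simp only [map_mul, rename_X]
      ring

/-- A polynomial vanishing on the isotropic cone is, modulo `qpoly`, of the form `A * X 0`, where
`A` does not involve `X 0` and is killed by the quadratic form in the other variables. -/
theorem exists_eq_qpoly_mul_add_of_eval_eq_zero {m : ℕ} (f : MvPolynomial (Fin (m + 1)) ℂ)
    (hf : ∀ a, dotC a a = 0 → eval a f = 0) :
    ∃ (g : MvPolynomial (Fin (m + 1)) ℂ) (A : MvPolynomial (Fin m) ℂ),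
      f = qpoly (m + 1) * g + rename Fin.succ A * X 0 ∧ A * qpoly m = 0 := by
  obtain ⟨g, A, B, rfl⟩ := exists_eq_qpoly_mul_add f
  have key (y : Fin m → ℂ) (s : ℂ) (hs : s ^ 2 = -eval y (qpoly m)) :
      eval y A * s + eval y B = 0 := by
    have hq : eval (Fin.cons s y : Fin (m + 1) → ℂ) (qpoly (m + 1)) = 0 := by
      rw [qpoly_succ, map_add, eval_rename]
      have : (Fin.cons s y : Fin (m + 1) → ℂ) ∘ Fin.succ = y := by funext j; simp
      rw [this]
      simp [hs]
    have h := hf (Fin.cons s y) (by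
      rw [← hq]
      simp [dotC, qpoly, pow_two])
    rw [map_add, map_mul, hq, zero_mul, zero_add, map_add, map_mul, eval_rename,
      eval_rename] at h
    have : (Fin.cons s y : Fin (m + 1) → ℂ) ∘ Fin.succ = y := by funext j; simp
    rw [this] at h
    simpa using h
  have both (y : Fin m → ℂ) : eval y B = 0 ∧ eval y (A * qpoly m) = 0 := by
    obtain ⟨s, hs⟩ := IsAlgClosed.exists_pow_nat_eq (-eval y (qpoly m)) (n := 2) (by norm_num)
    have h1 := key y s hs
    have h2 := key y (-s) (by rw [neg_sq, hs])
    refine ⟨by linear_combination (h1 + h2) / 2, ?_⟩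
    rw [map_mul]
    linear_combination (-s / 2) * (h1 - h2) + eval y A * hs
  have hB : B = 0 := MvPolynomial.funext fun y => by simpa using (both y).1
  exact ⟨g, A, by simp [hB], MvPolynomial.funext fun y => by simpa using (both y).2⟩

theorem qpoly_ne_zero {m : ℕ} (hm : m ≠ 0) : qpoly m ≠ 0 := by
  obtain ⟨k, rfl⟩ := Nat.exists_eq_succ_of_ne_zero hm
  intro h
  have := congrArg (eval (Pi.single 0 1 : Fin (k + 1) → ℂ)) h
  simp [qpoly, Fin.sum_univ_succ] at this

theorem apolarPairing_eq_zero_of_eval_eq_zero {n d : ℕ} (hn : 1 ≤ n) (hd : 2 ≤ d)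
    {h φ : MvPolynomial (Fin n) ℂ} (hh : h.IsHomogeneous d) (hl : lap h = 0)
    (hφ : ∀ a, dotC a a = 0 → eval a φ = 0) : apolarPairing h φ = 0 := by
  obtain ⟨m, rfl⟩ := Nat.exists_eq_add_of_le' hn
  obtain ⟨g, A, rfl, hA⟩ := exists_eq_qpoly_mul_add_of_eval_eq_zero φ hφ
  rw [map_add, apolarPairing_qpoly_mul h g hl, zero_add]
  rcases eq_or_ne m 0 with rfl | hm
  · obtain ⟨c, rfl⟩ := C_surjective (Fin 0) A
    have h0 : coeff (Finsupp.single 0 1) h = 0 := by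
      refine hh.coeff_eq_zero ?_
      rw [Finsupp.degree_single]
      omega
    rw [rename_C, ← pow_one (X 0), C_mul_X_pow_eq_monomial, apolarPairing_monomial, h0]
    simp
  · rw [(mul_eq_zero.mp hA).resolve_right (qpoly_ne_zero hm)]
    simp

/-- Every linear functional on forms of degree `d` is represented, under the apolar pairing,
by the polynomial `a ↦ L ((a · x) ^ d)`. -/
theorem exists_apolarPairing_eq {n : ℕ} (d : ℕ) (L : MvPolynomial (Fin n) ℂ →ₗ[ℂ] ℂ) :
    ∃ φ : MvPolynomial (Fin n) ℂ, (∀ a, eval a φ = L (linForm a ^ d)) ∧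
      ∀ h : MvPolynomial (Fin n) ℂ, h.IsHomogeneous d →
        apolarPairing h φ = (d.factorial : ℂ) * L h := by
  classical
  let e : (Fin n → ℕ) ≃ (Fin n →₀ ℕ) := Finsupp.equivFunOnFinite.symm
  refine ⟨∑ k ∈ Finset.piAntidiag Finset.univ d, monomial (e k)
    ((Nat.multinomial Finset.univ k : ℂ) * L (monomial (e k) 1)), fun a => ?_, fun h hh => ?_⟩
  · rw [linForm, Finset.sum_pow_eq_sum_piAntidiag, map_sum, map_sum]
    refine Finset.sum_congr rfl fun k _ => ?_
    have : (Nat.multinomial Finset.univ k : MvPolynomial (Fin n) ℂ) *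
        ∏ i, (C (a i) * X i) ^ k i =
        ((Nat.multinomial Finset.univ k : ℂ) * ∏ i, a i ^ k i) • monomial (e k) 1 := by
      rw [smul_eq_C_mul, monomial_eq, Finsupp.prod_fintype _ _ (by simp)]
      simp [mul_pow, Finset.prod_mul_distrib, e, mul_assoc]
    rw [this, map_smul, eval_monomial, Finsupp.prod_fintype _ _ (by simp)]
    simp only [e, Finsupp.coe_equivFunOnFinite_symm, smul_eq_mul]
    ring
  · have hsum : h = ∑ k ∈ Finset.piAntidiag Finset.univ d, coeff (e k) h • monomial (e k) 1 := by
      have hsub : h.support ⊆ (Finset.piAntidiag Finset.univ d).map e.toEmbedding := by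
        intro α hα
        rw [Finset.mem_map_equiv, Finset.mem_piAntidiag]
        refine ⟨?_, fun i _ => Finset.mem_univ i⟩
        by_contra hne
        exact mem_support_iff.mp hα
          (hh.coeff_eq_zero (by rwa [Finsupp.degree_eq_sum]))
      conv_lhs => rw [h.as_sum]
      rw [Finset.sum_subset hsub (fun α _ hα => by
        rw [notMem_support_iff.mp hα, monomial_zero]), Finset.sum_map]
      exact Finset.sum_congr rfl fun k _ => by simp [smul_monomial]
    conv_rhs => rw [hsum]
    rw [map_sum, map_sum, Finset.mul_sum]
    refine Finset.sum_congr rfl fun k hk => ?_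
    have hspec := Nat.multinomial_spec Finset.univ k
    rw [(Finset.mem_piAntidiag.mp hk).1] at hspec
    rw [apolarPairing_monomial, map_smul, ← hspec]
    simp only [e, Finsupp.coe_equivFunOnFinite_symm, smul_eq_mul]
    push_cast
    ring

/-- For n ≥ 1 and d ≥ 2: (1) (a·x)^d is harmonic iff a·a = 0;
(2) H_{n,d} is spanned by the d-th powers of linear forms of isotropic points. -/
theorem harmonic_powers_of_isotropic_linear_forms (n d : ℕ) (hn : 1 ≤ n) (hd : 2 ≤ d) :
    (∀ a : Fin n → ℂ, lap (linForm a ^ d) = 0 ↔ dotC a a = 0) ∧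
    ({h : MvPolynomial (Fin n) ℂ | h.IsHomogeneous d ∧ lap h = 0} =
      ↑(Submodule.span ℂ
        {p : MvPolynomial (Fin n) ℂ | ∃ a : Fin n → ℂ, dotC a a = 0 ∧ p = linForm a ^ d})) := by
  refine ⟨fun a => lap_linForm_pow_eq_zero_iff hd a, Set.Subset.antisymm ?_ ?_⟩
  · rintro h ⟨hh, hl⟩
    by_contra hmem
    obtain ⟨L, hL, hker⟩ := Submodule.exists_le_ker_of_notMem hmem
    obtain ⟨φ, hφ, hpair⟩ := exists_apolarPairing_eq d L
    have h0 := apolarPairing_eq_zero_of_eval_eq_zero hn hd hh hl (φ := φ) fun a ha => by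
      rw [hφ]
      exact hker (Submodule.subset_span ⟨a, ha, rfl⟩)
    rw [hpair h hh] at h0
    exact hL ((mul_eq_zero.mp h0).resolve_left (by exact_mod_cast d.factorial_ne_zero))
  · have hle : Submodule.span ℂ
        {p : MvPolynomial (Fin n) ℂ | ∃ a : Fin n → ℂ, dotC a a = 0 ∧ p = linForm a ^ d} ≤
        harmonicSubmodule n d := by
      rw [Submodule.span_le]
      rintro p ⟨a, ha, rfl⟩
      exact ⟨by simpa using (linForm_isHomogeneous a).pow d,
        (lap_linForm_pow_eq_zero_iff hd a).mpr ha⟩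
    exact hle
end

section
/- Let n ≥ 3 and suppose q_n^2 admits a tight Waring decomposition, i.e., suppose there exist points a_1,…,a_{T_{n,2}} ∈ ℂ^n with q_n^2 = Σ_{j=1}^{T_{n,2}} (a_j·x)^4, where T_{n,2} = binom(n+1, 2). Then n = 3 or n = m^2 − 2 for some odd natural number m. -/
open MvPolynomial

open Matrix in
theorem sum_dotProduct_mul_eq_of_quartic {ι κ : Type*} [Fintype ι] [Fintype κ] (a : κ → ι → ℂ)
    (h : ∀ x : ι → ℂ, ∑ k, (a k ⬝ᵥ x) ^ 4 = (x ⬝ᵥ x) ^ 2) (x y z w : ι → ℂ) :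
    ∑ k, (a k ⬝ᵥ x) * (a k ⬝ᵥ y) * (a k ⬝ᵥ z) * (a k ⬝ᵥ w) =
      1 / 3 * ((x ⬝ᵥ y) * (z ⬝ᵥ w) + (x ⬝ᵥ z) * (y ⬝ᵥ w) + (x ⬝ᵥ w) * (y ⬝ᵥ z)) := by
  have key : 24 * ∑ k, (a k ⬝ᵥ x) * (a k ⬝ᵥ y) * (a k ⬝ᵥ z) * (a k ⬝ᵥ w) =
      ∑ k, (a k ⬝ᵥ (x + y + z + w)) ^ 4
        - ∑ k, (a k ⬝ᵥ (x + y + z)) ^ 4 - ∑ k, (a k ⬝ᵥ (x + y + w)) ^ 4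
        - ∑ k, (a k ⬝ᵥ (x + z + w)) ^ 4 - ∑ k, (a k ⬝ᵥ (y + z + w)) ^ 4
        + ∑ k, (a k ⬝ᵥ (x + y)) ^ 4 + ∑ k, (a k ⬝ᵥ (x + z)) ^ 4 + ∑ k, (a k ⬝ᵥ (x + w)) ^ 4
        + ∑ k, (a k ⬝ᵥ (y + z)) ^ 4 + ∑ k, (a k ⬝ᵥ (y + w)) ^ 4 + ∑ k, (a k ⬝ᵥ (z + w)) ^ 4
        - ∑ k, (a k ⬝ᵥ x) ^ 4 - ∑ k, (a k ⬝ᵥ y) ^ 4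
        - ∑ k, (a k ⬝ᵥ z) ^ 4 - ∑ k, (a k ⬝ᵥ w) ^ 4 := by
    simp only [← Finset.sum_add_distrib, ← Finset.sum_sub_distrib, Finset.mul_sum,
      dotProduct_add]
    exact Finset.sum_congr rfl fun k _ => by ring
  simp only [h] at key
  simp only [dotProduct_add, add_dotProduct] at key
  rw [dotProduct_comm y x, dotProduct_comm z x, dotProduct_comm w x, dotProduct_comm z y,
    dotProduct_comm w y, dotProduct_comm w z] at key
  linear_combination key / 24

theorem sum_mul_eq_of_quartic {ι κ : Type*} [Fintype ι] [Fintype κ] [DecidableEq ι]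
    (a : κ → ι → ℂ) (h : ∀ x : ι → ℂ, ∑ k, (a k ⬝ᵥ x) ^ 4 = (x ⬝ᵥ x) ^ 2) (p q r s : ι) :
    ∑ k, a k p * a k q * a k r * a k s =
      1 / 3 * ((if p = q then 1 else 0) * (if r = s then 1 else 0)
        + (if p = r then 1 else 0) * (if q = s then 1 else 0)
        + (if p = s then 1 else 0) * (if q = r then 1 else 0)) := by
  simpa [Pi.single_apply, eq_comm] using
    sum_dotProduct_mul_eq_of_quartic a h (Pi.single p 1) (Pi.single q 1) (Pi.single r 1)
      (Pi.single s 1)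

theorem sum_quadratic_mul_eq_of_quartic {ι κ : Type*} [Fintype ι] [Fintype κ] [DecidableEq ι]
    (a : κ → ι → ℂ) (h : ∀ x : ι → ℂ, ∑ k, (a k ⬝ᵥ x) ^ 4 = (x ⬝ᵥ x) ^ 2)
    (f : Sym2 ι → ℂ) (p q : ι) :
    ∑ k, (∑ r, ∑ s, f s(r, s) * (a k r * a k s)) * (a k p * a k q) =
      1 / 3 * ((∑ r, f s(r, r)) * (if p = q then 1 else 0) + 2 * f s(p, q)) := by
  have h1 : ∑ k, (∑ r, ∑ s, f s(r, s) * (a k r * a k s)) * (a k p * a k q) =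
      ∑ r, ∑ s, f s(r, s) * ∑ k, a k p * a k q * a k r * a k s := by
    simp only [Finset.sum_mul, Finset.mul_sum]
    rw [Finset.sum_comm]
    refine Finset.sum_congr rfl fun r _ => ?_
    rw [Finset.sum_comm]
    exact Finset.sum_congr rfl fun s _ => Finset.sum_congr rfl fun k _ => by ring
  rw [h1]
  simp only [sum_mul_eq_of_quartic a h, mul_add, Finset.sum_add_distrib]
  simp only [mul_ite, mul_one, mul_zero, Finset.sum_ite_eq,
    Finset.sum_ite_irrel, Finset.sum_const_zero, Finset.mem_univ, if_true, Finset.mul_sum,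
    Sym2.eq_swap (a := q) (b := p)]
  split_ifs
  · rw [← Finset.sum_mul]
    simp only [← Finset.mul_sum]
    ring
  · ring

open Matrix in
theorem dotProduct_sq_of_tight_quartic {ι κ : Type*} [Fintype ι] [Fintype κ] [DecidableEq ι]
    [DecidableEq κ] (hcard : Fintype.card κ = (Fintype.card ι + 1).choose 2)
    (a : κ → ι → ℂ) (h : ∀ x : ι → ℂ, ∑ k, (a k ⬝ᵥ x) ^ 4 = (x ⬝ᵥ x) ^ 2) (j k : κ) :
    (Fintype.card ι + 2) * (a j ⬝ᵥ a k) ^ 2 = (a j ⬝ᵥ a j) * (a k ⬝ᵥ a k) +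
      2 / 3 * (Fintype.card ι + 2) * (if j = k then 1 else 0) := by
  have hn : (Fintype.card ι + 2 : ℂ) ≠ 0 := by exact_mod_cast (Fintype.card ι + 1).succ_ne_zero
  let ev : (Sym2 ι → ℂ) →ₗ[ℂ] (κ → ℂ) :=
    { toFun := fun f k => ∑ r, ∑ s, f s(r, s) * (a k r * a k s)
      map_add' := fun f g => by ext; simp [add_mul, Finset.sum_add_distrib]
      map_smul' := fun c f => by ext; simp [Finset.mul_sum, mul_assoc] }
  have hev : ∀ f k, ev f k = ∑ r, ∑ s, f s(r, s) * (a k r * a k s) := fun _ _ => rfl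
  have hsum : ∀ f p q, ∑ k, ev f k * (a k p * a k q) =
      1 / 3 * ((∑ r, f s(r, r)) * (if p = q then 1 else 0) + 2 * f s(p, q)) :=
    sum_quadratic_mul_eq_of_quartic a h
  have hinj : Function.Injective ev := by
    rw [injective_iff_map_eq_zero]
    intro f hf
    have h0 : ∀ p q, 1 / 3 * ((∑ r, f s(r, r)) * (if p = q then 1 else 0) + 2 * f s(p, q)) = 0 := by
      intro p q
      rw [← hsum f p q, hf]
      simp
    have htr : (∑ r, f s(r, r)) = 0 := by
      have h2 := Finset.sum_eq_zero fun p (_ : p ∈ Finset.univ) => h0 p p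
      simp only [if_true, mul_one, ← Finset.mul_sum, Finset.sum_add_distrib, Finset.sum_const,
        Finset.card_univ, nsmul_eq_mul] at h2
      refine (mul_eq_zero.mp ?_).resolve_left hn
      linear_combination 3 * h2
    ext z
    induction z with
    | _ p q =>
      have h3 := h0 p q
      rw [htr] at h3
      simpa using h3
  have hsurj : Function.Surjective ev :=
    (LinearMap.injective_iff_surjective_of_finrank_eq_finrank (by simp [Sym2.card, hcard])).mp hinj
  obtain ⟨f, hf⟩ := hsurj (Pi.single k 1)
  have hk : ∀ p q, a k p * a k q =
      1 / 3 * ((∑ r, f s(r, r)) * (if p = q then 1 else 0) + 2 * f s(p, q)) := by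
    intro p q
    rw [← hsum f p q, hf]
    simp [Pi.single_apply]
  have htr : a k ⬝ᵥ a k = 1 / 3 * ((Fintype.card ι + 2) * ∑ r, f s(r, r)) := by
    simp only [dotProduct, hk, if_true, mul_one, ← Finset.mul_sum, Finset.sum_add_distrib,
      Finset.sum_const, Finset.card_univ, nsmul_eq_mul]
    ring
  have hjk : (a j ⬝ᵥ a k) ^ 2 = 1 / 3 * ((∑ r, f s(r, r)) * (a j ⬝ᵥ a j) + 2 * ev f j) := by
    have h1 : (a j ⬝ᵥ a k) ^ 2 = ∑ p, ∑ q, (a j p * a j q) * (a k p * a k q) := by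
      rw [sq, dotProduct, Finset.sum_mul_sum]
      exact Finset.sum_congr rfl fun p _ => Finset.sum_congr rfl fun q _ => by ring
    have h2 : ∀ p q, (a j p * a j q) * (a k p * a k q) =
        (if p = q then 1 / 3 * (∑ r, f s(r, r)) * (a j p * a j q) else 0) +
          2 / 3 * (f s(p, q) * (a j p * a j q)) := by
      intro p q
      rw [hk]
      split_ifs <;> ring
    rw [h1, hev]
    simp only [h2, Finset.sum_add_distrib, Finset.sum_ite_eq, Finset.mem_univ, if_true,
      ← Finset.mul_sum, dotProduct]
    ring
  rw [hjk, htr, hf, Pi.single_apply]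
  ring

open Matrix in
theorem sum_norm_mul_dotProduct_of_quartic {ι κ : Type*} [Fintype ι] [Fintype κ] [DecidableEq ι]
    (a : κ → ι → ℂ) (h : ∀ x : ι → ℂ, ∑ k, (a k ⬝ᵥ x) ^ 4 = (x ⬝ᵥ x) ^ 2) (x y : ι → ℂ) :
    ∑ k, (a k ⬝ᵥ a k) * ((a k ⬝ᵥ x) * (a k ⬝ᵥ y)) = (Fintype.card ι + 2) / 3 * (x ⬝ᵥ y) := by
  have h1 : ∑ k, (a k ⬝ᵥ a k) * ((a k ⬝ᵥ x) * (a k ⬝ᵥ y)) =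
      ∑ p, ∑ k, (a k ⬝ᵥ x) * (a k ⬝ᵥ y) * (a k ⬝ᵥ Pi.single p 1) * (a k ⬝ᵥ Pi.single p 1) := by
    rw [Finset.sum_comm]
    refine Finset.sum_congr rfl fun k _ => ?_
    simp only [dotProduct_single, mul_one]
    rw [dotProduct, Finset.sum_mul]
    exact Finset.sum_congr rfl fun p _ => by ring
  rw [h1]
  simp only [sum_dotProduct_mul_eq_of_quartic a h]
  simp only [← Finset.mul_sum, Finset.sum_add_distrib,
    dotProduct_single, mul_one, Pi.single_eq_same, Finset.sum_const, Finset.card_univ,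
    nsmul_eq_mul]
  simp only [dotProduct]
  ring

open Matrix in
theorem exists_equiangular_of_tight_quartic {ι κ : Type*} [Fintype ι] [Fintype κ] [DecidableEq ι]
    [DecidableEq κ] (hcard : Fintype.card κ = (Fintype.card ι + 1).choose 2)
    (a : κ → ι → ℂ) (h : ∀ x : ι → ℂ, ∑ k, (a k ⬝ᵥ x) ^ 4 = (x ⬝ᵥ x) ^ 2) :
    ∃ b : κ → ι → ℂ, (∀ k, b k ⬝ᵥ b k = 1) ∧
      (∀ j k, j ≠ k → (Fintype.card ι + 2) * (b j ⬝ᵥ b k) ^ 2 = 1) ∧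
      ∀ i j, ∑ k, (b i ⬝ᵥ b k) * (b k ⬝ᵥ b j) = (Fintype.card ι + 1) / 2 * (b i ⬝ᵥ b j) := by
  have hn2 : (Fintype.card ι + 2 : ℂ) ≠ 0 := by exact_mod_cast (Fintype.card ι + 1).succ_ne_zero
  have hn1 : (Fintype.card ι + 1 : ℂ) ≠ 0 := by exact_mod_cast (Fintype.card ι).succ_ne_zero
  have hnorm : ∀ k, 3 * (Fintype.card ι + 1) * (a k ⬝ᵥ a k) ^ 2 = 2 * (Fintype.card ι + 2) := by
    intro k
    have := dotProduct_sq_of_tight_quartic hcard a h k k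
    rw [if_pos rfl] at this
    linear_combination 3 * this
  choose ρ hρ using fun k => IsAlgClosed.exists_pow_nat_eq (a k ⬝ᵥ a k) two_pos
  have hρ0 : ∀ k, ρ k ≠ 0 := by
    intro k hk
    have := hnorm k
    rw [← hρ, hk] at this
    simp [hn2] at this
  refine ⟨fun k => (ρ k)⁻¹ • a k, fun k => ?_, fun j k hjk => ?_, fun i j => ?_⟩
  · simp only [smul_dotProduct, dotProduct_smul, smul_eq_mul, ← hρ k]
    field_simp [hρ0 k]
  · have := dotProduct_sq_of_tight_quartic hcard a h j k
    rw [if_neg hjk, ← hρ j, ← hρ k] at this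
    simp only [smul_dotProduct, dotProduct_smul, smul_eq_mul]
    have hj := hρ0 j
    have hk := hρ0 k
    field_simp
    linear_combination this
  · have := sum_norm_mul_dotProduct_of_quartic a h (a i) (a j)
    simp only [smul_dotProduct, dotProduct_smul, smul_eq_mul]
    have h1 : ∀ k, (ρ k)⁻¹ * ((ρ i)⁻¹ * (a i ⬝ᵥ a k)) * ((ρ j)⁻¹ * ((ρ k)⁻¹ * (a k ⬝ᵥ a j))) =
        3 * (Fintype.card ι + 1) / (2 * (Fintype.card ι + 2)) * ((ρ i)⁻¹ * (ρ j)⁻¹) *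
          ((a k ⬝ᵥ a k) * ((a k ⬝ᵥ a i) * (a k ⬝ᵥ a j))) := by
      intro k
      have hk := hnorm k
      have hi := hρ0 i
      have hj := hρ0 j
      have hk0 := hρ0 k
      rw [dotProduct_comm (a i) (a k)]
      rw [← hρ k] at hk ⊢
      field_simp
      linear_combination -(a k ⬝ᵥ a i) * (a k ⬝ᵥ a j) * hk
    have h2 := Finset.sum_congr rfl fun k (_ : k ∈ Finset.univ) => h1 k
    rw [← Finset.mul_sum, this] at h2
    rw [h2]
    field_simp

open Matrix in
theorem det_dotProduct_eq_zero {ι κ : Type*} [Fintype ι] [Fintype κ] [DecidableEq κ]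
    (b : κ → ι → ℂ) (hcard : Fintype.card ι < Fintype.card κ) :
    (Matrix.of fun i j => b i ⬝ᵥ b j).det = 0 := by
  by_contra hdet
  have hu := Matrix.rank_of_isUnit _ ((Matrix.isUnit_iff_isUnit_det _).mpr (isUnit_iff_ne_zero.mpr hdet))
  have h1 : (Matrix.of fun i j => b i ⬝ᵥ b j) = Matrix.of b * (Matrix.of b)ᵀ := by
    ext i j
    simp [Matrix.mul_apply, dotProduct]
  have h2 := (Matrix.rank_mul_le_left (Matrix.of b) (Matrix.of b)ᵀ).trans (Matrix.rank_le_card_width _)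
  rw [← h1, hu] at h2
  omega

open Matrix in
theorem odd_det_of_even_diag_of_odd_offDiag {κ : Type*} [Fintype κ] [DecidableEq κ]
    (hcard : Even (Fintype.card κ)) (Z : Matrix κ κ ℤ) (hdiag : ∀ i, Even (Z i i))
    (hoff : ∀ i j, i ≠ j → Odd (Z i j)) : Odd Z.det := by
  have hZ : Z.map (Int.castRingHom (ZMod 2)) = Matrix.of (fun _ _ => 1) - 1 := by
    ext i j
    by_cases hij : i = j
    · subst hij
      simpa [ZMod.intCast_eq_zero_iff_even] using hdiag i
    · simpa [hij, ZMod.intCast_eq_one_iff_odd] using hoff i j hij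
  have hJ : (Matrix.of (fun _ _ => 1) : Matrix κ κ (ZMod 2)) * Matrix.of (fun _ _ => 1) = 0 := by
    ext i j
    simpa [Matrix.mul_apply, ZMod.natCast_eq_zero_iff_even] using hcard
  have hsq : Z.map (Int.castRingHom (ZMod 2)) * Z.map (Int.castRingHom (ZMod 2)) = 1 := by
    rw [hZ, sub_mul, mul_sub, hJ]
    ext i j
    simp [CharTwo.neg_eq, CharTwo.sub_eq_add, ← add_assoc, CharTwo.add_self_eq_zero]
  have hdet := congrArg Matrix.det hsq
  rw [Matrix.det_mul, Matrix.det_one, ← RingHom.mapMatrix_apply, ← RingHom.map_det] at hdet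
  rw [← Int.not_even_iff_odd, ← ZMod.intCast_eq_zero_iff_even]
  intro h0
  simp [h0] at hdet

theorem exists_sq_of_equiangular {ι κ : Type*} [Fintype ι] [Fintype κ] [DecidableEq κ]
    (hι : Fintype.card ι ≠ 3) (b : κ → ι → ℂ) (hb : ∀ k, b k ⬝ᵥ b k = 1)
    (hoff : ∀ j k, j ≠ k → (Fintype.card ι + 2) * (b j ⬝ᵥ b k) ^ 2 = 1)
    (hsum : ∀ i j, ∑ k, (b i ⬝ᵥ b k) * (b k ⬝ᵥ b j) =
      (Fintype.card ι + 1) / 2 * (b i ⬝ᵥ b j))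
    {i j : κ} (hij : i ≠ j) : ∃ m : ℕ, m ^ 2 = Fintype.card ι + 2 := by
  obtain ⟨μ, hμ⟩ := IsAlgClosed.exists_pow_nat_eq (Fintype.card ι + 2 : ℂ) two_pos
  have hmem : ∀ j k, j ≠ k → μ * (b j ⬝ᵥ b k) ∈ (Int.castRingHom ℂ).range := by
    intro j k hjk
    have h1 := hoff j k hjk
    rw [← hμ, ← mul_pow] at h1
    rcases sq_eq_one_iff.mp h1 with h1 | h1
    · exact ⟨1, by simp [h1]⟩
    · exact ⟨-1, by simp [h1]⟩
  have hrest : ∑ k ∈ (Finset.univ.erase i).erase j, (μ * (b i ⬝ᵥ b k)) * (μ * (b k ⬝ᵥ b j)) ∈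
      (Int.castRingHom ℂ).range := by
    refine sum_mem fun k hk => ?_
    simp only [Finset.mem_erase] at hk
    exact mul_mem (hmem i k (Ne.symm hk.2.1)) (hmem k j hk.1)
  obtain ⟨w, hw⟩ := hrest
  have hsplit := hsum i j
  rw [← Finset.add_sum_erase _ _ (Finset.mem_univ i),
    ← Finset.add_sum_erase _ _ (Finset.mem_erase.mpr ⟨hij.symm, Finset.mem_univ j⟩), hb, hb]
    at hsplit
  have hw' : (w : ℂ) = μ ^ 2 *
      ∑ k ∈ (Finset.univ.erase i).erase j, (b i ⬝ᵥ b k) * (b k ⬝ᵥ b j) := by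
    rw [← eq_intCast (Int.castRingHom ℂ), hw, Finset.mul_sum]
    exact Finset.sum_congr rfl fun k _ => by ring
  have hw2 : 2 * (w : ℂ) = μ ^ 2 * (Fintype.card ι - 3) * (b i ⬝ᵥ b j) := by
    linear_combination 2 * hw' + 2 * μ ^ 2 * hsplit
  have hsqC : (2 * (w : ℂ)) ^ 2 = (Fintype.card ι + 2) * (Fintype.card ι - 3) ^ 2 := by
    have hoffij := hoff i j hij
    rw [← hμ] at hoffij ⊢
    rw [hw2]
    linear_combination μ ^ 2 * (Fintype.card ι - 3 : ℂ) ^ 2 * hoffij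
  have hsqQ : (2 * (w : ℚ)) ^ 2 = (Fintype.card ι + 2) * (Fintype.card ι - 3) ^ 2 := by
    exact_mod_cast hsqC
  have h3 : (Fintype.card ι - 3 : ℚ) ≠ 0 := by
    rw [sub_ne_zero]
    exact_mod_cast hι
  have hIs : IsSquare ((Fintype.card ι + 2 : ℕ) : ℚ) := by
    refine ⟨2 * w / (Fintype.card ι - 3), ?_⟩
    push_cast
    field_simp
    linear_combination -hsqQ
  obtain ⟨m, hm⟩ := Rat.isSquare_natCast_iff.mp hIs
  exact ⟨m, by rw [hm, sq]⟩

theorem odd_of_equiangular {ι κ : Type*} [Fintype ι] [Fintype κ] [DecidableEq κ]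
    (hcard : Fintype.card ι + 2 ≤ Fintype.card κ) (b : κ → ι → ℂ) (hb : ∀ k, b k ⬝ᵥ b k = 1)
    (hoff : ∀ j k, j ≠ k → (Fintype.card ι + 2) * (b j ⬝ᵥ b k) ^ 2 = 1)
    {m : ℕ} (hm : m ^ 2 = Fintype.card ι + 2) : Odd m := by
  by_contra hodd
  rw [Nat.not_odd_iff_even] at hodd
  obtain ⟨e⟩ : Nonempty (Fin (Fintype.card ι + 2) ↪ κ) :=
    Function.Embedding.nonempty_of_card_le (by simpa using hcard)
  have hent : ∀ i j, ∃ z : ℤ, (z : ℂ) = m * (b (e i) ⬝ᵥ b (e j)) ∧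
      (i = j → Even z) ∧ (i ≠ j → Odd z) := by
    intro i j
    by_cases hij : i = j
    · subst hij
      exact ⟨m, by simp [hb], fun _ => by exact_mod_cast hodd, fun h => absurd rfl h⟩
    · have h1 := hoff (e i) (e j) (e.injective.ne hij)
      have h2 : (Fintype.card ι + 2 : ℂ) = m ^ 2 := by exact_mod_cast hm.symm
      rw [h2, ← mul_pow] at h1
      rcases sq_eq_one_iff.mp h1 with h1 | h1
      · exact ⟨1, by simp [h1], fun h => absurd h hij, fun _ => odd_one⟩
      · exact ⟨-1, by simp [h1], fun h => absurd h hij, fun _ => odd_neg_one⟩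
  choose Z hZ hdiag hoffd using hent
  have hdetodd : Odd (Matrix.of Z).det := by
    refine odd_det_of_even_diag_of_odd_offDiag ?_ _ (fun i => hdiag i i rfl) hoffd
    rw [Fintype.card_fin, ← hm]
    exact hodd.pow_of_ne_zero two_ne_zero
  have hmap : (Matrix.of Z).map (Int.castRingHom ℂ) =
      (m : ℂ) • Matrix.of fun i j => b (e i) ⬝ᵥ b (e j) := by
    ext i j
    simp [hZ]
  have hdet := congrArg Matrix.det hmap
  rw [Matrix.det_smul, det_dotProduct_eq_zero (fun i => b (e i)) (by simp), mul_zero,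
    ← RingHom.mapMatrix_apply, ← RingHom.map_det, eq_intCast, Int.cast_eq_zero] at hdet
  rw [hdet] at hdetodd
  exact absurd hdetodd (by decide)

/-- If q_n^2 (n ≥ 3) admits a tight Waring decomposition into T_{n,2} fourth
powers of linear forms, then n = 3 or n = m² − 2 for some odd m. -/
theorem tight_decomposition_square_of_quadric (n : ℕ) (hn : 3 ≤ n)
    (a : Fin ((n + 1).choose 2) → Fin n → ℂ)
    (hdec : qpoly n ^ 2 = ∑ k, linForm (a k) ^ 4) :
    n = 3 ∨ ∃ m : ℕ, Odd m ∧ n = m ^ 2 - 2 := by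
  rw [or_iff_not_imp_left]
  intro hn3
  have hquartic : ∀ x : Fin n → ℂ, ∑ k, (a k ⬝ᵥ x) ^ 4 = (x ⬝ᵥ x) ^ 2 := by
    intro x
    have := congrArg (eval x) hdec
    simpa [qpoly, linForm, dotProduct, sq] using this.symm
  obtain ⟨b, hb, hoff, hsum⟩ := exists_equiangular_of_tight_quartic (by simp) a hquartic
  have hle : n + 2 ≤ (n + 1).choose 2 := by
    rw [Nat.choose_two_right, Nat.le_div_iff_mul_le two_pos, Nat.add_sub_cancel]
    nlinarith
  have hij : (⟨0, by omega⟩ : Fin ((n + 1).choose 2)) ≠ ⟨1, by omega⟩ := by simp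
  obtain ⟨m, hm⟩ := exists_sq_of_equiangular (by simpa using hn3) b hb hoff hsum hij
  refine ⟨m, odd_of_equiangular (by simpa using hle) b hb hoff hm, ?_⟩
  rw [hm, Fintype.card_fin, Nat.add_sub_cancel]
end

section
/- Let n ≥ 1, let a ∈ ℂ^n with a·a = 1, let B_{n,4} = 8(n+4)(n+6)/(35(n+1)(n+3)), and set f = (1/B_{n,4})·q_n^4 − (a·x)^8. Then the kernel of the middle catalecticant map Cat_{f,4} is the one-dimensional space spanned by (n+6)·(a·Y)^4 − 6·q_n(Y)·(a·Y)^2 + (3/(n+4))·q_n(Y)^2, where a·Y = a_1Y_1+⋯+a_nY_n and q_n(Y) = Y_1^2+⋯+Y_n^2. -/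
open MvPolynomial

namespace MvPolynomial

theorem pderiv_pderiv_comm {σ R : Type*} [CommRing R] (i j : σ) (f : MvPolynomial σ R) :
    pderiv i (pderiv j f) = pderiv j (pderiv i f) := by
  classical
  have h : ⁅pderiv (R := R) i, pderiv (R := R) j⁆ = 0 := by
    refine derivation_ext fun k => ?_
    simp only [Derivation.commutator_apply, pderiv_X, Derivation.zero_apply]
    simp [Pi.single_apply, apply_ite]
  have := congrArg (fun D => D f) h
  simpa [Derivation.commutator_apply, sub_eq_zero] using this

variable {n : ℕ}

open scoped IsMulCommutative in
/-- The apolarity action as an algebra homomorphism into the endomorphism algebra. -/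
theorem exists_algHom_diffOp (n : ℕ) :
    ∃ Φ : MvPolynomial (Fin n) ℂ →ₐ[ℂ] Module.End ℂ (MvPolynomial (Fin n) ℂ),
      (∀ i g, Φ (X i) g = pderiv i g) ∧ ∀ φ g, diffOp φ g = Φ φ g := by
  let s : Set (Module.End ℂ (MvPolynomial (Fin n) ℂ)) :=
    Set.range fun i : Fin n => (pderiv i).toLinearMap
  have hs : ∀ a ∈ s, ∀ b ∈ s, a * b = b * a := by
    rintro _ ⟨i, rfl⟩ _ ⟨j, rfl⟩
    exact LinearMap.ext fun f => pderiv_pderiv_comm i j f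
  have := Algebra.isMulCommutative_adjoin ℂ hs
  let g : Fin n → Algebra.adjoin ℂ s := fun i => ⟨_, Algebra.subset_adjoin ⟨i, rfl⟩⟩
  refine ⟨(Algebra.adjoin ℂ s).val.comp (aeval g), fun i f => ?_, fun φ f => ?_⟩
  · simp only [AlgHom.comp_apply, aeval_X]
    rfl
  · rw [AlgHom.comp_apply, aeval_def, eval₂_eq', map_sum, LinearMap.sum_apply, diffOp]
    refine Finset.sum_congr rfl fun d _ => ?_
    rw [← List.prod_ofFn, map_mul, map_list_prod, List.map_ofFn, AlgHom.commutes,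
      Module.End.mul_apply, Module.algebraMap_end_apply]
    rfl

theorem diffOp_sub (φ ψ f : MvPolynomial (Fin n) ℂ) :
    diffOp (φ - ψ) f = diffOp φ f - diffOp ψ f := by
  obtain ⟨Φ, -, hΦ⟩ := exists_algHom_diffOp n
  simp [hΦ]

theorem diffOp_smul (c : ℂ) (φ f : MvPolynomial (Fin n) ℂ) :
    diffOp (c • φ) f = c • diffOp φ f := by
  obtain ⟨Φ, -, hΦ⟩ := exists_algHom_diffOp n
  simp [hΦ]

theorem diffOp_sub_right (φ f g : MvPolynomial (Fin n) ℂ) :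
    diffOp φ (f - g) = diffOp φ f - diffOp φ g := by
  obtain ⟨Φ, -, hΦ⟩ := exists_algHom_diffOp n
  simp [hΦ]

theorem diffOp_C_mul_right (c : ℂ) (φ f : MvPolynomial (Fin n) ℂ) :
    diffOp φ (C c * f) = C c * diffOp φ f := by
  obtain ⟨Φ, -, hΦ⟩ := exists_algHom_diffOp n
  simp [hΦ, ← smul_eq_C_mul]

theorem diffOp_C (c : ℂ) (f : MvPolynomial (Fin n) ℂ) : diffOp (C c) f = C c * f := by
  obtain ⟨Φ, -, hΦ⟩ := exists_algHom_diffOp n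
  rw [hΦ, ← algebraMap_eq, AlgHom.commutes, Module.algebraMap_end_apply, smul_eq_C_mul,
    algebraMap_eq]

theorem IsHomogeneous.sum_X_mul_pderiv' {φ : MvPolynomial (Fin n) ℂ} {d : ℕ}
    (h : φ.IsHomogeneous d) : ∑ i, X i * pderiv i φ = (d : MvPolynomial (Fin n) ℂ) * φ := by
  rw [h.sum_X_mul_pderiv, nsmul_eq_mul]

/-- Euler's identity reduces the action of `φ` to that of its partial derivatives. -/
theorem IsHomogeneous.natCast_mul_diffOp {φ : MvPolynomial (Fin n) ℂ} {d : ℕ}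
    (h : φ.IsHomogeneous d) (f : MvPolynomial (Fin n) ℂ) :
    (d : MvPolynomial (Fin n) ℂ) * diffOp φ f = ∑ i, pderiv i (diffOp (pderiv i φ) f) := by
  obtain ⟨Φ, hX, hΦ⟩ := exists_algHom_diffOp n
  have := congrArg (fun ψ => Φ ψ f) h.sum_X_mul_pderiv
  simp only [nsmul_eq_mul, map_sum, map_mul, map_natCast, LinearMap.sum_apply,
    Module.End.mul_apply, Module.End.natCast_apply, hX] at this
  simp only [hΦ, this]

theorem pderiv_qpoly (i : Fin n) : pderiv i (qpoly n) = 2 * X i := by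
  classical
  simp [qpoly, pderiv_X, Pi.single_apply]

theorem pderiv_linForm (a : Fin n → ℂ) (i : Fin n) : pderiv i (linForm a) = C (a i) := by
  classical
  simp [linForm, pderiv_X, Pi.single_apply]

theorem qpoly_isHomogeneous (n : ℕ) : (qpoly n).IsHomogeneous 2 :=
  IsHomogeneous.sum _ _ _ fun i _ => isHomogeneous_X_pow i 2

theorem linForm_isHomogeneous (a : Fin n → ℂ) : (linForm a).IsHomogeneous 1 :=
  IsHomogeneous.sum _ _ _ fun i _ => isHomogeneous_C_mul_X (a i) i

theorem lap_pderiv (i : Fin n) (f : MvPolynomial (Fin n) ℂ) :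
    lap (pderiv i f) = pderiv i (lap f) := by
  simp only [lap, map_sum]
  refine Finset.sum_congr rfl fun j _ => ?_
  rw [pderiv_pderiv_comm j i, pderiv_pderiv_comm j i]

theorem lap_add (f g : MvPolynomial (Fin n) ℂ) : lap (f + g) = lap f + lap g := by
  simp [lap, Finset.sum_add_distrib]

theorem lap_sub (f g : MvPolynomial (Fin n) ℂ) : lap (f - g) = lap f - lap g := by
  simp [lap]

theorem lap_C_mul (c : ℂ) (f : MvPolynomial (Fin n) ℂ) : lap (C c * f) = C c * lap f := by
  simp [lap, Finset.mul_sum]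

theorem lap_C (c : ℂ) : lap (C c : MvPolynomial (Fin n) ℂ) = 0 := by
  simp [lap]

theorem IsHomogeneous.lap {φ : MvPolynomial (Fin n) ℂ} {d : ℕ} (h : φ.IsHomogeneous (d + 2)) :
    (lap φ).IsHomogeneous d :=
  IsHomogeneous.sum _ _ _ fun _ _ => h.pderiv.pderiv

theorem IsHomogeneous.sum_pderiv_qpoly_pow_mul_pderiv {φ : MvPolynomial (Fin n) ℂ} {d : ℕ}
    (h : φ.IsHomogeneous d) (m : ℕ) :
    ∑ i, pderiv i (qpoly n ^ m * pderiv i φ) =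
      2 * m * d * qpoly n ^ (m - 1) * φ + qpoly n ^ m * _root_.lap φ := by
  have : ∀ i, pderiv i (qpoly n ^ m * pderiv i φ) =
      2 * (m : MvPolynomial (Fin n) ℂ) * qpoly n ^ (m - 1) * (X i * pderiv i φ) + qpoly n ^ m * pderiv i (pderiv i φ) := by
    intro i
    rw [pderiv_mul, pderiv_pow, pderiv_qpoly]
    ring
  simp only [this, Finset.sum_add_distrib, ← Finset.mul_sum, h.sum_X_mul_pderiv', _root_.lap]
  ring

theorem IsHomogeneous.lap_qpoly_mul {φ : MvPolynomial (Fin n) ℂ} {d : ℕ}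
    (h : φ.IsHomogeneous d) :
    _root_.lap (qpoly n * φ) = (2 * n + 4 * d) * φ + qpoly n * _root_.lap φ := by
  have : ∀ i, pderiv i (pderiv i (qpoly n * φ)) =
      2 * φ + 4 * (X i * pderiv i φ) + qpoly n * pderiv i (pderiv i φ) := by
    intro i
    have h2 : pderiv i (2 : MvPolynomial (Fin n) ℂ) = 0 := by
      rw [← map_ofNat C, pderiv_C]
    simp only [pderiv_mul, pderiv_qpoly, map_add, pderiv_X_self, h2]
    ring
  rw [_root_.lap]
  simp only [this, Finset.sum_add_distrib, ← Finset.mul_sum, h.sum_X_mul_pderiv', _root_.lap]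
  simp
  ring

theorem lap_linForm_pow (a : Fin n → ℂ) (ha : dotC a a = 1) (m : ℕ) :
    lap (linForm a ^ m) = (m : MvPolynomial (Fin n) ℂ) * (m - 1 : ℕ) * linForm a ^ (m - 2) := by
  have hm (k : ℕ) (i : Fin n) : pderiv i (k : MvPolynomial (Fin n) ℂ) = 0 := by
    rw [← C_eq_coe_nat, pderiv_C]
  have : ∀ i, pderiv i (pderiv i (linForm a ^ m)) =
      (m : MvPolynomial (Fin n) ℂ) * ((m - 1 : ℕ) : MvPolynomial (Fin n) ℂ) * linForm a ^ (m - 2) * C (a i * a i) := by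
    intro i
    simp only [pderiv_pow, pderiv_mul, pderiv_linForm, pderiv_C, hm, C_mul, Nat.sub_sub]
    ring
  simp only [lap, this, ← Finset.mul_sum, ← map_sum]
  rw [dotC] at ha
  simp [ha]

theorem IsHomogeneous.diffOp_linForm_pow {φ : MvPolynomial (Fin n) ℂ} {d : ℕ}
    (h : φ.IsHomogeneous d) (a : Fin n → ℂ) (m : ℕ) :
    diffOp φ (linForm a ^ m) =
      (m.descFactorial d : MvPolynomial (Fin n) ℂ) * C (eval a φ) * linForm a ^ (m - d) := by
  induction d generalizing φ with
  | zero =>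
    rw [← totalDegree_zero_iff_isHomogeneous, totalDegree_eq_zero_iff_eq_C] at h
    rw [h, diffOp_C]
    simp
  | succ d ih =>
    have key := h.natCast_mul_diffOp (linForm a ^ m)
    have e := congrArg (fun ψ => C (σ := Fin n) (eval a ψ)) h.sum_X_mul_pderiv'
    simp only [map_sum, map_mul, eval_X, map_natCast] at e
    have hm (k : ℕ) (i : Fin n) : pderiv i (k : MvPolynomial (Fin n) ℂ) = 0 := by
      rw [← C_eq_coe_nat, pderiv_C]
    have : ∀ i, pderiv i (diffOp (pderiv i φ) (linForm a ^ m)) =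
        (m.descFactorial (d + 1) : MvPolynomial (Fin n) ℂ) * linForm a ^ (m - (d + 1)) *
          (C (a i) * C (eval a (pderiv i φ))) := by
      intro i
      rw [ih h.pderiv]
      simp only [pderiv_pow, pderiv_mul, pderiv_linForm, pderiv_C, hm, Nat.sub_sub,
        Nat.descFactorial_succ, Nat.cast_mul]
      ring
    simp only [this, ← Finset.mul_sum, e] at key
    have h0 : ((d + 1 : ℕ) : MvPolynomial (Fin n) ℂ) ≠ 0 := Nat.cast_ne_zero.2 (by omega)
    refine mul_left_cancel₀ h0 (key.trans ?_)
    ring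

theorem IsHomogeneous.diffOp_qpoly_pow_four_one {φ : MvPolynomial (Fin n) ℂ}
    (h : φ.IsHomogeneous 1) : diffOp φ (qpoly n ^ 4) = 8 * (qpoly n ^ 3 * φ) := by
  have key := h.natCast_mul_diffOp (qpoly n ^ 4)
  have h0 (i : Fin n) : diffOp (pderiv i φ) (qpoly n ^ 4) = qpoly n ^ 4 * pderiv i φ := by
    have := h.pderiv (i := i)
    rw [← totalDegree_zero_iff_isHomogeneous, totalDegree_eq_zero_iff_eq_C] at this
    rw [this, diffOp_C, mul_comm]
  have h1 : _root_.lap φ = 0 := by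
    refine Finset.sum_eq_zero fun i _ => ?_
    have := h.pderiv (i := i)
    rw [← totalDegree_zero_iff_isHomogeneous, totalDegree_eq_zero_iff_eq_C] at this
    rw [this, pderiv_C]
  simp only [h0, h.sum_pderiv_qpoly_pow_mul_pderiv, h1] at key
  norm_num at key
  rw [key]
  ring

theorem pderiv_ofNat_mul (i : Fin n) (k : ℕ) [k.AtLeastTwo] (f : MvPolynomial (Fin n) ℂ) :
    pderiv i (ofNat(k) * f) = ofNat(k) * pderiv i f := by
  rw [← map_ofNat C, pderiv_C_mul]

theorem IsHomogeneous.diffOp_qpoly_pow_four_two {φ : MvPolynomial (Fin n) ℂ}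
    (h : φ.IsHomogeneous 2) :
    diffOp φ (qpoly n ^ 4) = 48 * (qpoly n ^ 2 * φ) + 4 * (qpoly n ^ 3 * _root_.lap φ) := by
  have key := h.natCast_mul_diffOp (qpoly n ^ 4)
  simp only [h.pderiv.diffOp_qpoly_pow_four_one, pderiv_ofNat_mul, ← Finset.mul_sum,
    h.sum_pderiv_qpoly_pow_mul_pderiv] at key
  push_cast at key
  refine mul_left_cancel₀ (two_ne_zero (α := MvPolynomial (Fin n) ℂ)) (key.trans ?_)
  ring

theorem IsHomogeneous.diffOp_qpoly_pow_four_three {φ : MvPolynomial (Fin n) ℂ}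
    (h : φ.IsHomogeneous 3) :
    diffOp φ (qpoly n ^ 4) = 192 * (qpoly n ^ 1 * φ) + 24 * (qpoly n ^ 2 * _root_.lap φ) := by
  have key := h.natCast_mul_diffOp (qpoly n ^ 4)
  have h1 := IsHomogeneous.lap (d := 1) h
  have h2 : _root_.lap (_root_.lap φ) = 0 := by
    refine Finset.sum_eq_zero fun i _ => ?_
    have := h1.pderiv (i := i)
    rw [← totalDegree_zero_iff_isHomogeneous, totalDegree_eq_zero_iff_eq_C] at this
    rw [this, pderiv_C]
  simp only [h.pderiv.diffOp_qpoly_pow_four_two, map_add, lap_pderiv, pderiv_ofNat_mul,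
    Finset.sum_add_distrib, ← Finset.mul_sum, h.sum_pderiv_qpoly_pow_mul_pderiv,
    h1.sum_pderiv_qpoly_pow_mul_pderiv, h2] at key
  push_cast at key
  refine mul_left_cancel₀ (show (3 : MvPolynomial (Fin n) ℂ) ≠ 0 by norm_num) (key.trans ?_)
  ring

theorem IsHomogeneous.diffOp_qpoly_pow_four_four {φ : MvPolynomial (Fin n) ℂ}
    (h : φ.IsHomogeneous 4) :
    diffOp φ (qpoly n ^ 4) = 384 * φ + 96 * (qpoly n * _root_.lap φ) +
      6 * (qpoly n ^ 2 * _root_.lap (_root_.lap φ)) := by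
  have key := h.natCast_mul_diffOp (qpoly n ^ 4)
  have h1 := IsHomogeneous.lap (d := 2) h
  simp only [h.pderiv.diffOp_qpoly_pow_four_three, map_add, lap_pderiv, pderiv_ofNat_mul,
    Finset.sum_add_distrib, ← Finset.mul_sum, h.sum_pderiv_qpoly_pow_mul_pderiv,
    h1.sum_pderiv_qpoly_pow_mul_pderiv] at key
  push_cast at key
  refine mul_left_cancel₀ (show (4 : MvPolynomial (Fin n) ℂ) ≠ 0 by norm_num) (key.trans ?_)
  ring

theorem lap_qpoly (n : ℕ) : lap (qpoly n) = 2 * n := by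
  have := (isHomogeneous_one (Fin n) ℂ).lap_qpoly_mul
  have h1 : lap (1 : MvPolynomial (Fin n) ℂ) = 0 := by rw [← C_1, lap_C]
  simpa [h1] using this

theorem lap_qpoly_sq (n : ℕ) : lap (qpoly n ^ 2) = (4 * (n : MvPolynomial (Fin n) ℂ) + 8) * qpoly n := by
  rw [sq, (qpoly_isHomogeneous n).lap_qpoly_mul, lap_qpoly]
  push_cast
  ring

/-- The middle catalecticant of `qpoly n ^ 4` is injective. -/
theorem IsHomogeneous.eq_zero_of_diffOp_qpoly_pow_four {φ : MvPolynomial (Fin n) ℂ}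
    (h : φ.IsHomogeneous 4) (h0 : diffOp φ (qpoly n ^ 4) = 0) : φ = 0 := by
  rw [h.diffOp_qpoly_pow_four_four] at h0
  have h1 := IsHomogeneous.lap (d := 2) h
  have h2 := IsHomogeneous.lap (d := 0) h1
  rw [← totalDegree_zero_iff_isHomogeneous, totalDegree_eq_zero_iff_eq_C] at h2
  generalize coeff 0 (_root_.lap (_root_.lap φ)) = w at h2
  generalize hu : _root_.lap φ = u at *
  have lap_ofNat_mul (k : ℕ) [k.AtLeastTwo] (f : MvPolynomial (Fin n) ℂ) :
      _root_.lap (ofNat(k) * f) = ofNat(k) * _root_.lap f := by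
    rw [← map_ofNat C, lap_C_mul]
  have lap_natCast_mul (k : ℕ) (f : MvPolynomial (Fin n) ℂ) :
      _root_.lap ((k : MvPolynomial (Fin n) ℂ) * f) = k * _root_.lap f := by
    rw [← C_eq_coe_nat, lap_C_mul]
  have e1 := congrArg _root_.lap h0
  rw [h2, mul_comm _ (C w)] at e1
  simp only [lap_add, lap_ofNat_mul, lap_C_mul, h1.lap_qpoly_mul, lap_qpoly_sq, hu, h2] at e1
  rw [← C_0, lap_C] at e1
  have e2 := congrArg _root_.lap (show ((192 * n + 1152 : ℕ) : MvPolynomial (Fin n) ℂ) * u +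
    ((24 * n + 144 : ℕ) : MvPolynomial (Fin n) ℂ) * (C w * qpoly n) = 0 by push_cast; linear_combination e1)
  rw [← C_0, lap_C, lap_add, lap_natCast_mul, lap_natCast_mul, lap_C_mul, lap_qpoly, h2] at e2
  have hw : C w = (0 : MvPolynomial (Fin n) ℂ) := by
    have : ((192 * n + 1152 + (24 * n + 144) * (2 * n) : ℕ) : MvPolynomial (Fin n) ℂ) * C w
        = 0 := by
      push_cast at e2 ⊢
      linear_combination e2
    exact (mul_eq_zero.1 this).resolve_left (Nat.cast_ne_zero.2 (by omega))
  have hu0 : u = 0 := by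
    have : ((192 * n + 1152 : ℕ) : MvPolynomial (Fin n) ℂ) * u = 0 := by
      rw [hw] at e1
      push_cast
      linear_combination e1
    exact (mul_eq_zero.1 this).resolve_left (Nat.cast_ne_zero.2 (by omega))
  rw [h2, hw, hu0] at h0
  have : (384 : MvPolynomial (Fin n) ℂ) * φ = 0 := by linear_combination h0
  exact (mul_eq_zero.1 this).resolve_left (by norm_num)

theorem eval_linForm_self (a : Fin n → ℂ) : eval a (linForm a) = dotC a a := by
  simp [linForm, dotC]

theorem eval_qpoly_self (a : Fin n → ℂ) : eval a (qpoly n) = dotC a a := by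
  simp [qpoly, dotC, sq]

/-- The generator of the kernel of the middle catalecticant. -/
noncomputable def kernelForm (a : Fin n → ℂ) : MvPolynomial (Fin n) ℂ :=
  C ((n : ℂ) + 6) * linForm a ^ 4 - C 6 * (qpoly n * linForm a ^ 2) +
    C (3 / ((n : ℂ) + 4)) * qpoly n ^ 2

theorem kernelForm_isHomogeneous (a : Fin n → ℂ) : (kernelForm a).IsHomogeneous 4 := by
  have hq := qpoly_isHomogeneous n
  have hl := linForm_isHomogeneous a
  exact (((hl.pow 4).C_mul _).sub ((hq.mul (hl.pow 2)).C_mul _)).add ((hq.pow 2).C_mul _)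

theorem eval_kernelForm (a : Fin n → ℂ) (ha : dotC a a = 1) :
    eval a (kernelForm a) = ((n : ℂ) + 1) * (n + 3) / (n + 4) := by
  have h4 : (n : ℂ) + 4 ≠ 0 := by exact_mod_cast (show n + 4 ≠ 0 by omega)
  simp only [kernelForm, map_add, map_sub, map_mul, map_pow, eval_C, eval_linForm_self,
    eval_qpoly_self, ha]
  field_simp
  ring

theorem diffOp_kernelForm_qpoly_pow_four (a : Fin n → ℂ) (ha : dotC a a = 1) :
    diffOp (kernelForm a) (qpoly n ^ 4) = C (384 * ((n : ℂ) + 6)) * linForm a ^ 4 := by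
  have hl2 : lap (linForm a ^ 2) = 2 := by simp [lap_linForm_pow a ha]
  have hl4 : lap (linForm a ^ 4) = 12 * linForm a ^ 2 := by
    rw [lap_linForm_pow a ha]
    norm_num
  have hql := ((linForm_isHomogeneous a).pow 2).lap_qpoly_mul
  have h4 : (n : ℂ) + 4 ≠ 0 := by exact_mod_cast (show n + 4 ≠ 0 by omega)
  have hC : C (3 / ((n : ℂ) + 4)) * ((n : MvPolynomial (Fin n) ℂ) + 4) = 3 := by
    have := congrArg (C (σ := Fin n)) (div_mul_cancel₀ (3 : ℂ) h4)
    rwa [C_mul, C_add, map_natCast, map_ofNat, map_ofNat] at this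
  have h1 : lap (kernelForm a) =
      C 24 * linForm a ^ 2 - C (8 * (3 / ((n : ℂ) + 4))) * qpoly n := by
    rw [kernelForm, lap_add, lap_sub, lap_C_mul, lap_C_mul, lap_C_mul, hl4, hql, hl2,
      lap_qpoly_sq]
    simp only [map_add, map_mul, map_natCast, map_ofNat]
    push_cast
    linear_combination 4 * qpoly n * hC
  rw [(kernelForm_isHomogeneous a).diffOp_qpoly_pow_four_four, h1, lap_sub, lap_C_mul,
    lap_C_mul, hl2, lap_qpoly, kernelForm]
  simp only [map_add, map_mul, map_natCast, map_ofNat]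
  linear_combination (-96) * qpoly n ^ 2 * hC

end MvPolynomial

/-- For a·a = 1 and f = (1/B_{n,4})·q_n^4 − (a·x)^8 with
B_{n,4} = 8(n+4)(n+6)/(35(n+1)(n+3)), the kernel of Cat_{f,4} is spanned by
(n+6)(a·Y)⁴ − 6·q_n(Y)·(a·Y)² + (3/(n+4))·q_n(Y)². -/
theorem kernel_middle_catalecticant_s4 (n : ℕ) (hn : 1 ≤ n)
    (a : Fin n → ℂ) (ha : dotC a a = 1) (f : MvPolynomial (Fin n) ℂ)
    (hf : f = C ((8 * ((n : ℂ) + 4) * ((n : ℂ) + 6) /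
          (35 * ((n : ℂ) + 1) * ((n : ℂ) + 3)))⁻¹) * qpoly n ^ 4 - linForm a ^ 8) :
    ∀ φ : MvPolynomial (Fin n) ℂ,
      (φ.IsHomogeneous 4 ∧ diffOp φ f = 0) ↔
        ∃ c : ℂ, φ = c • (C ((n : ℂ) + 6) * linForm a ^ 4 -
          C 6 * (qpoly n * linForm a ^ 2) + C (3 / ((n : ℂ) + 4)) * qpoly n ^ 2) := by
  intro φ
  have h1 : (n : ℂ) + 1 ≠ 0 := by exact_mod_cast (show n + 1 ≠ 0 by omega)
  have h3 : (n : ℂ) + 3 ≠ 0 := by exact_mod_cast (show n + 3 ≠ 0 by omega)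
  have h4 : (n : ℂ) + 4 ≠ 0 := by exact_mod_cast (show n + 4 ≠ 0 by omega)
  have h6 : (n : ℂ) + 6 ≠ 0 := by exact_mod_cast (show n + 6 ≠ 0 by omega)
  set B : ℂ := 8 * ((n : ℂ) + 4) * ((n : ℂ) + 6) / (35 * ((n : ℂ) + 1) * ((n : ℂ) + 3)) with hB
  have hB0 : B ≠ 0 := by
    simp [hB, h1, h3, h4, h6]
  have hdiff {ψ : MvPolynomial (Fin n) ℂ} (hψ : ψ.IsHomogeneous 4) :
      diffOp ψ f = C B⁻¹ * diffOp ψ (qpoly n ^ 4) - C (1680 * eval a ψ) * linForm a ^ 4 := by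
    rw [hf, diffOp_sub_right, diffOp_C_mul_right, hψ.diffOp_linForm_pow, C_mul, map_ofNat]
    norm_num [Nat.descFactorial]
  change _ ↔ ∃ c : ℂ, φ = c • kernelForm a
  have hK := kernelForm_isHomogeneous a
  constructor
  · rintro ⟨hφ, h0⟩
    rw [hdiff hφ, sub_eq_zero] at h0
    have hq : diffOp φ (qpoly n ^ 4) = C (B * (1680 * eval a φ)) * linForm a ^ 4 := by
      rw [C_mul, mul_assoc, ← h0, ← mul_assoc, ← C_mul, mul_inv_cancel₀ hB0, C_1, one_mul]
    set c : ℂ := B * (1680 * eval a φ) / (384 * ((n : ℂ) + 6)) with hc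
    have hcK : (c • kernelForm a).IsHomogeneous 4 := by
      rw [smul_eq_C_mul]
      exact hK.C_mul c
    refine ⟨c, sub_eq_zero.1 ((hφ.sub hcK).eq_zero_of_diffOp_qpoly_pow_four ?_)⟩
    rw [diffOp_sub, diffOp_smul, diffOp_kernelForm_qpoly_pow_four a ha, hq, smul_eq_C_mul,
      ← mul_assoc (C c), ← C_mul, hc, div_mul_cancel₀ _ (by simpa using h6), sub_self]
  · rintro ⟨c, rfl⟩
    refine ⟨?_, ?_⟩
    · rw [smul_eq_C_mul]
      exact hK.C_mul c
    · rw [diffOp_smul, hdiff hK, diffOp_kernelForm_qpoly_pow_four a ha, eval_kernelForm a ha,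
        ← mul_assoc, ← C_mul, ← sub_mul, ← C_sub]
      have : B⁻¹ * (384 * ((n : ℂ) + 6)) -
          1680 * (((n : ℂ) + 1) * (n + 3) / (n + 4)) = 0 := by
        rw [hB]
        field_simp
        ring
      rw [this, C_0, zero_mul, smul_zero]
end
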